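/- arXiv:math/0212004 — 6 statements merged into one kernel-verified Lean document; each statement's English description precedes it below -/
import Mathlib

section
/- There exists a constant c > 0 such that for all sufficiently large n there are at least 2^(c·n^(5/4)) pairwise combinatorially non-isomorphic simplicial 3-spheres on n vertices; that is, one can exhibit a family of at least 2^(c·n^(5/4)) simplicial complexes, each having exactly n vertices and each with underlying space homeomorphic to the 3-dimensional sphere S³, such that no two distinct members of the family admit a bijection between their vertex sets carrying faces to faces. -/
open Geometry

noncomputable instance (d : ℕ) : DecidableEq (EuclideanSpace ℝ (Fin d)) :=
  Classical.decEq _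

/-- Two (geometric) simplicial complexes, possibly living in different ambient spaces,
are *combinatorially isomorphic* if there is a bijection between their vertex sets
that induces a bijection between their sets of faces. -/
def CombinatoriallyIsomorphic {E E' : Type*} [AddCommGroup E] [Module ℝ E]
    [AddCommGroup E'] [Module ℝ E'] [DecidableEq E']
    (K : SimplicialComplex ℝ E) (L : SimplicialComplex ℝ E') : Prop :=
  ∃ f : E → E', Set.BijOn f K.vertices L.vertices ∧
    (∀ s ∈ K.faces, s.image f ∈ L.faces) ∧
    (∀ t ∈ L.faces, ∃ s ∈ K.faces, s.image f = t)

open Finset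

/-- An abstract complex on a finite vertex type together with a position for each vertex such that
nonnegative weights supported on faces are determined by their total mass and weighted sum. -/
structure PlacedComplex (V E : Type*) [Fintype V] [AddCommGroup E] [Module ℝ E] where
  pos : V → E
  IsFace : Finset V → Prop
  mono : ∀ {S T}, IsFace T → S ⊆ T → IsFace S
  singleton : ∀ v, IsFace {v}
  unique : ∀ {w w' : V → ℝ} {S S' : Finset V}, IsFace S → IsFace S' → (∀ v, 0 ≤ w v) →
    (∀ v, 0 ≤ w' v) → (∀ v, w v ≠ 0 → v ∈ S) → (∀ v, w' v ≠ 0 → v ∈ S') →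
    ∑ v, w v = ∑ v, w' v → ∑ v, w v • pos v = ∑ v, w' v • pos v → w = w'

namespace PlacedComplex

variable {V E : Type*} [Fintype V] [DecidableEq V] [AddCommGroup E] [Module ℝ E] [DecidableEq E]
  (P : PlacedComplex V E)

omit [DecidableEq E] in
lemma pos_injective : Function.Injective P.pos := by
  intro u v huv
  have h := P.unique (w := Pi.single u 1) (w' := Pi.single v 1) (P.singleton u) (P.singleton v)
    (fun x => by by_cases h : x = u <;> simp [h])
    (fun x => by by_cases h : x = v <;> simp [h])
    (fun x => by simp [Pi.single_apply]) (fun x => by simp [Pi.single_apply])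
    (by simp) (by simp [Pi.single_apply, huv])
  have := congrFun h u
  by_contra hne
  simp [hne] at this

lemma mem_convexHull_image {S : Finset V} {x : E} :
    x ∈ convexHull ℝ (S.image P.pos : Set E) ↔
      ∃ w : V → ℝ, (∀ v, 0 ≤ w v) ∧ (∀ v, w v ≠ 0 → v ∈ S) ∧ ∑ v, w v = 1 ∧
        ∑ v, w v • P.pos v = x := by
  rw [Finset.mem_convexHull']
  constructor
  · rintro ⟨u, hu, hu1, hux⟩
    rw [sum_image P.pos_injective.injOn] at hu1 hux
    refine ⟨fun v => if v ∈ S then u (P.pos v) else 0, fun v => ?_, fun v => by simp +contextual,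
      by simpa using hu1, by simpa [ite_smul] using hux⟩
    dsimp only
    split_ifs with h
    · exact hu _ (mem_image_of_mem _ h)
    · exact le_rfl
  · rintro ⟨w, hw, hS, hw1, hwx⟩
    have hz : ∀ v, v ∉ S → w v = 0 := fun v hv => by
      by_contra h
      exact hv (hS v h)
    refine ⟨fun y => ∑ v, if P.pos v = y then w v else 0,
      fun y _ => sum_nonneg fun v _ => by split_ifs <;> simp [hw], ?_, ?_⟩
    · rw [sum_image P.pos_injective.injOn]
      simp only [P.pos_injective.eq_iff, sum_ite_eq', mem_univ, if_true]
      rw [← hw1]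
      exact sum_subset (subset_univ _) fun v _ hv => hz v hv
    · rw [sum_image P.pos_injective.injOn]
      simp only [P.pos_injective.eq_iff, sum_ite_eq', mem_univ, if_true]
      rw [← hwx]
      exact sum_subset (subset_univ _) fun v _ hv => by simp [hz v hv]

omit [DecidableEq V] [DecidableEq E] in
lemma eq_zero_of_sum_eq_zero {S : Finset V} (hS : P.IsFace S) {w : V → ℝ}
    (hw : ∀ v, w v ≠ 0 → v ∈ S) (h0 : ∑ v, w v = 0) (hp : ∑ v, w v • P.pos v = 0) : w = 0 := by
  have key : (fun v => (w v)⁺) = fun v => (w v)⁻ := by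
    refine P.unique hS hS (fun v => posPart_nonneg _) (fun v => negPart_nonneg _)
      (fun v hv => hw v fun h => hv (by simp [h])) (fun v hv => hw v fun h => hv (by simp [h]))
      ?_ ?_
    · rw [← sub_eq_zero, ← sum_sub_distrib]
      simpa [posPart_sub_negPart] using h0
    · rw [← sub_eq_zero, ← sum_sub_distrib]
      simpa [← sub_smul, posPart_sub_negPart] using hp
  funext v
  have := congrFun key v
  have h := posPart_sub_negPart (w v)
  simp only [Pi.zero_apply]
  linarith

lemma affineIndependent_image {S : Finset V} (hS : P.IsFace S) :
    AffineIndependent ℝ ((↑) : {x // x ∈ S.image P.pos} → E) := by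
  have h1 : AffineIndependent ℝ (fun v : S => P.pos v) := by
    rw [affineIndependent_iff]
    intro t u h0 hp v hv
    have h := P.eq_zero_of_sum_eq_zero hS
      (w := fun x => if hx : x ∈ S then (if (⟨x, hx⟩ : S) ∈ t then u ⟨x, hx⟩ else 0) else 0)
      (fun x hx => by by_contra h; simp [h] at hx) ?_ ?_
    · have := congrFun h v
      simpa [hv] using this
    · refine Eq.trans ?_ h0
      rw [← sum_subset (subset_univ S) (fun x _ hx => dif_neg hx), ← sum_coe_sort S]
      simp [-univ_eq_attach]
    · refine Eq.trans ?_ hp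
      rw [← sum_subset (subset_univ S) (fun x _ hx => by rw [dif_neg hx, zero_smul]),
        ← sum_coe_sort S]
      simp [ite_smul, -univ_eq_attach]
  have h2 := h1.range
  have h3 : Set.range (fun v : S => P.pos v) = ((S.image P.pos : Finset E) : Set E) := by
    ext; simp
  rw [h3] at h2
  exact h2

/-- The geometric realization of a placed complex. -/
def toSimplicialComplex : SimplicialComplex ℝ E where
  faces := {s | ∃ S, P.IsFace S ∧ S.Nonempty ∧ S.image P.pos = s}
  isRelLowerSet_faces := by
    rintro s ⟨S, hS, hne, rfl⟩
    refine ⟨hne.image _, fun t ht htne => ?_⟩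
    obtain ⟨T, hT, rfl⟩ := subset_image_iff.1 ht
    exact ⟨T, P.mono hS hT, by simpa using htne, rfl⟩
  indep := by
    rintro s ⟨S, hS, -, rfl⟩
    exact P.affineIndependent_image hS
  inter_subset_convexHull := by
    rintro s t ⟨S, hS, -, rfl⟩ ⟨T, hT, -, rfl⟩ x ⟨hxS, hxT⟩
    obtain ⟨w, hw, hwS, hw1, hwx⟩ := P.mem_convexHull_image.1 hxS
    obtain ⟨w', hw', hwT, hw1', hwx'⟩ := P.mem_convexHull_image.1 hxT
    obtain rfl := P.unique hS hT hw hw' hwS hwT (hw1.trans hw1'.symm) (hwx.trans hwx'.symm)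
    rw [← coe_inter, ← image_inter _ _ P.pos_injective]
    exact P.mem_convexHull_image.2 ⟨w, hw, fun v hv => mem_inter.2 ⟨hwS v hv, hwT v hv⟩, hw1, hwx⟩

lemma image_mem_faces {S : Finset V} :
    S.image P.pos ∈ P.toSimplicialComplex.faces ↔ P.IsFace S ∧ S.Nonempty := by
  constructor
  · rintro ⟨T, hT, hne, h⟩
    obtain rfl := image_injective P.pos_injective h
    exact ⟨hT, hne⟩
  · exact fun h => ⟨S, h.1, h.2, rfl⟩

lemma vertices_eq : P.toSimplicialComplex.vertices = Set.range P.pos := by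
  ext x
  rw [SimplicialComplex.mem_vertices]
  constructor
  · rintro ⟨S, -, ⟨v, hv⟩, h⟩
    have := mem_image_of_mem P.pos hv
    rw [h, mem_singleton] at this
    exact ⟨v, this⟩
  · rintro ⟨v, rfl⟩
    exact ⟨{v}, P.singleton v, by simp, by simp⟩

lemma mem_space {x : E} : x ∈ P.toSimplicialComplex.space ↔
    ∃ w : V → ℝ, ∃ S, P.IsFace S ∧ (∀ v, 0 ≤ w v) ∧ (∀ v, w v ≠ 0 → v ∈ S) ∧ ∑ v, w v = 1 ∧
        ∑ v, w v • P.pos v = x := by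
  rw [SimplicialComplex.mem_space_iff]
  constructor
  · rintro ⟨s, ⟨S, hS, -, rfl⟩, hx⟩
    obtain ⟨w, hw⟩ := P.mem_convexHull_image.1 hx
    exact ⟨w, S, hS, hw⟩
  · rintro ⟨w, S, hS, hw⟩
    refine ⟨S.image P.pos, P.image_mem_faces.2 ⟨hS, ?_⟩, P.mem_convexHull_image.2 ⟨w, hw⟩⟩
    by_contra hne
    obtain rfl := not_nonempty_iff_eq_empty.1 hne
    have : ∀ v, w v = 0 := fun v => by
      by_contra h
      simpa using hw.2.1 v h
    have h1 := hw.2.2.1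
    simp [this] at h1

lemma exists_perm_of_combinatoriallyIsomorphic {E' : Type*} [AddCommGroup E'] [Module ℝ E']
    [DecidableEq E'] (P : PlacedComplex V E) (Q : PlacedComplex V E')
    (h : CombinatoriallyIsomorphic P.toSimplicialComplex Q.toSimplicialComplex) :
    ∃ σ : Equiv.Perm V, ∀ S : Finset V, S.Nonempty → (P.IsFace S ↔ Q.IsFace (S.image σ)) := by
  obtain ⟨f, hf, h1, h2⟩ := h
  rw [vertices_eq, vertices_eq] at hf
  choose σ hσ using fun v => hf.mapsTo (Set.mem_range_self v)
  have hinj : Function.Injective (f ∘ P.pos) := fun u v huv =>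
    P.pos_injective (hf.injOn (Set.mem_range_self u) (Set.mem_range_self v) huv)
  have hcomp : Q.pos ∘ σ = f ∘ P.pos := funext hσ
  have hσi : Function.Injective σ := Function.Injective.of_comp (hcomp ▸ hinj)
  have himage : ∀ S : Finset V, (S.image P.pos).image f = (S.image σ).image Q.pos := fun S => by
    rw [image_image, image_image, hcomp]
  refine ⟨Equiv.ofBijective σ (Finite.injective_iff_bijective.1 hσi), fun S hS => ?_⟩
  change _ ↔ Q.IsFace (S.image σ)
  constructor
  · intro hP
    have := h1 _ (P.image_mem_faces.2 ⟨hP, hS⟩)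
    rw [himage] at this
    exact (Q.image_mem_faces.1 this).1
  · intro hQ
    obtain ⟨s, ⟨T, hT, -, rfl⟩, hs⟩ := h2 _ (Q.image_mem_faces.2 ⟨hQ, hS.image σ⟩)
    rw [← himage, image_image, image_image] at hs
    exact image_injective hinj hs ▸ hT

end PlacedComplex

section Line

variable {n : ℕ} {u u' : Fin (n + 1) → ℝ} {i i' : ℕ}

lemma le_of_weight_ne_zero (hu : ∀ r, 0 ≤ u r) (hs : ∀ r, u r ≠ 0 → (r : ℕ) = i' ∨ (r : ℕ) = i' + 1)
    (h : i * ∑ r, u r ≤ ∑ r, u r * (r : ℕ)) {r : Fin (n + 1)} (hr : u r ≠ 0) : i ≤ r := by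
  by_contra! hlt
  have hi : i' + 1 ≤ i := by have := hs r hr; omega
  have hnn : ∀ s ∈ univ, 0 ≤ u s * (i - (s : ℕ)) := fun s _ => by
    by_cases h0 : u s = 0
    · simp [h0]
    · refine mul_nonneg (hu s) (sub_nonneg.2 (Nat.cast_le.2 ?_))
      have := hs s h0
      omega
  have h1 : ∑ r, u r * (i - (r : ℕ)) = 0 := by
    refine le_antisymm ?_ (sum_nonneg hnn)
    simp only [mul_sub, sum_sub_distrib, ← sum_mul]
    linarith
  rw [sum_eq_zero_iff_of_nonneg hnn] at h1
  rcases mul_eq_zero.1 (h1 r (mem_univ _)) with h2 | h2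
  · exact hr h2
  · have : (r : ℝ) < i := by exact_mod_cast hlt
    linarith

lemma weight_le_of_ne_zero (hu : ∀ r, 0 ≤ u r) (hs : ∀ r, u r ≠ 0 → (r : ℕ) = i' ∨ (r : ℕ) = i' + 1)
    (h : ∑ r, u r * (r : ℕ) ≤ (i + 1) * ∑ r, u r) {r : Fin (n + 1)} (hr : u r ≠ 0) :
    (r : ℕ) ≤ i + 1 := by
  by_contra! hlt
  have hi : i + 1 ≤ i' := by have := hs r hr; omega
  have hnn : ∀ s ∈ univ, 0 ≤ u s * ((s : ℕ) - (i + 1)) := fun s _ => by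
    by_cases h0 : u s = 0
    · simp [h0]
    · refine mul_nonneg (hu s) (sub_nonneg.2 ?_)
      have := hs s h0
      exact_mod_cast (by omega : i + 1 ≤ (s : ℕ))
  have h1 : ∑ r, u r * ((r : ℕ) - (i + 1)) = 0 := by
    refine le_antisymm ?_ (sum_nonneg hnn)
    simp only [mul_sub, sum_sub_distrib, ← sum_mul]
    linarith
  rw [sum_eq_zero_iff_of_nonneg hnn] at h1
  rcases mul_eq_zero.1 (h1 r (mem_univ _)) with h2 | h2
  · exact hr h2
  · have : (i : ℝ) + 1 < r := by exact_mod_cast hlt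
    linarith

lemma eq_of_sum_eq_of_sum_mul_eq (hs : ∀ r, u r ≠ 0 → (r : ℕ) = i ∨ (r : ℕ) = i + 1)
    (hs' : ∀ r, u' r ≠ 0 → (r : ℕ) = i ∨ (r : ℕ) = i + 1) (h0 : ∑ r, u r = ∑ r, u' r)
    (h1 : ∑ r, u r * (r : ℕ) = ∑ r, u' r * (r : ℕ)) : u = u' := by
  have hd : ∀ r : Fin (n + 1), ¬ ((r : ℕ) = i ∨ (r : ℕ) = i + 1) → u r - u' r = 0 := fun r hr => by
    rw [not_ne_iff.1 (mt (hs r) hr), not_ne_iff.1 (mt (hs' r) hr), sub_self]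
  have key : ∀ c : ℝ, ∑ r, (u r - u' r) * ((r : ℕ) - c) = 0 := fun c => by
    simp only [mul_sub, sub_mul, sum_sub_distrib, ← sum_mul]
    linarith [congrArg (· * c) h0]
  funext r
  rw [← sub_eq_zero]
  by_cases hr : (r : ℕ) = i ∨ (r : ℕ) = i + 1
  · rcases hr with hr | hr
    · have := key (i + 1)
      rw [sum_eq_single r] at this
      · rw [hr] at this
        linarith
      · intro s _ hsr
        by_cases hsi : (s : ℕ) = i + 1
        · simp [hsi]
        · rw [hd s (by have := Fin.val_ne_of_ne hsr; omega), zero_mul]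
      · simp
    · have := key i
      rw [sum_eq_single r] at this
      · rw [hr] at this
        push_cast at this
        linarith
      · intro s _ hsr
        by_cases hsi : (s : ℕ) = i
        · simp [hsi]
        · rw [hd s (by have := Fin.val_ne_of_ne hsr; omega), zero_mul]
      · simp
  · exact hd r hr

lemma exists_weights {p x : ℝ} (hi : i < n) (h0 : i * p ≤ x) (h1 : x ≤ (i + 1) * p) :
    ∃ u : Fin (n + 1) → ℝ, (∀ r, 0 ≤ u r) ∧ (∀ r, u r ≠ 0 → (r : ℕ) = i ∨ (r : ℕ) = i + 1) ∧
      ∑ r, u r = p ∧ ∑ r, u r * (r : ℕ) = x := by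
  refine ⟨Pi.single ⟨i, by omega⟩ ((i + 1) * p - x) + Pi.single ⟨i + 1, by omega⟩ (x - i * p),
    fun r => ?_, fun r => ?_, ?_, ?_⟩
  · refine add_nonneg ?_ ?_ <;> rw [Pi.single_apply] <;> split_ifs <;> linarith
  · contrapose!
    intro h
    rw [Pi.add_apply, Pi.single_eq_of_ne, Pi.single_eq_of_ne, add_zero] <;>
      rw [Ne, Fin.ext_iff] <;> simp [h]
  · simp only [Pi.add_apply, sum_add_distrib, sum_pi_single', mem_univ, if_true]
    ring
  · simp only [Pi.add_apply, add_mul, sum_add_distrib, Pi.single_apply, ite_mul, zero_mul,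
      sum_ite_eq', mem_univ, if_true]
    push_cast
    ring

lemma exists_interval {p x : ℝ} (hn : 0 < n) (h0 : 0 ≤ x) (h1 : x ≤ n * p) :
    ∃ i < n, i * p ≤ x ∧ x ≤ (i + 1) * p := by
  induction n, hn using Nat.le_induction with
  | base => exact ⟨0, by simp, by simpa using h0, by simpa using h1⟩
  | succ n hn ih =>
    by_cases h : x ≤ n * p
    · obtain ⟨i, hi, h⟩ := ih h
      exact ⟨i, by omega, h⟩
    · exact ⟨n, by omega, (not_le.1 h).le, by simpa using h1⟩

end Line

/-- Coordinates `(p, q, x, y)` of a point of `ℝ⁴`; the join of the segments `[0, A]` and `[0, B]` is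
placed in the hyperplane `p + q = 1`, the first at `q = 0` and the second at `p = 0`.
`InCell i j` is the cone over the join of `[i, i + 1]` and `[j, j + 1]`. -/
def InCell (i j : ℕ) (X : EuclideanSpace ℝ (Fin 4)) : Prop :=
  i * X 0 ≤ X 2 ∧ X 2 ≤ (i + 1) * X 0 ∧ j * X 1 ≤ X 3 ∧ X 3 ≤ (j + 1) * X 1

namespace InCell

variable {i j : ℕ} {X Y : EuclideanSpace ℝ (Fin 4)}

lemma zero : InCell i j 0 := by simp [InCell]

lemma add (hX : InCell i j X) (hY : InCell i j Y) : InCell i j (X + Y) := by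
  obtain ⟨h1, h2, h3, h4⟩ := hX
  obtain ⟨h5, h6, h7, h8⟩ := hY
  simp only [InCell, PiLp.add_apply, mul_add]
  refine ⟨?_, ?_, ?_, ?_⟩ <;> linarith

lemma smul {c : ℝ} (hc : 0 ≤ c) (hX : InCell i j X) : InCell i j (c • X) := by
  obtain ⟨h1, h2, h3, h4⟩ := hX
  simp only [InCell, PiLp.smul_apply, smul_eq_mul]
  refine ⟨?_, ?_, ?_, ?_⟩
  · linarith [mul_le_mul_of_nonneg_left h1 hc]
  · linarith [mul_le_mul_of_nonneg_left h2 hc]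
  · linarith [mul_le_mul_of_nonneg_left h3 hc]
  · linarith [mul_le_mul_of_nonneg_left h4 hc]

lemma sum {α : Type*} {s : Finset α} {f : α → EuclideanSpace ℝ (Fin 4)}
    (h : ∀ a ∈ s, InCell i j (f a)) : InCell i j (∑ a ∈ s, f a) :=
  sum_induction f (InCell i j) (fun _ _ => add) zero h

lemma isClosed (i j : ℕ) : IsClosed {X | InCell i j X} := by
  refine IsClosed.and (isClosed_le ?_ ?_) (.and (isClosed_le ?_ ?_)
    (.and (isClosed_le ?_ ?_) (isClosed_le ?_ ?_))) <;> fun_prop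

lemma nonneg (hX : InCell i j X) : 0 ≤ X 0 ∧ 0 ≤ X 1 := by
  obtain ⟨h1, h2, h3, h4⟩ := hX
  constructor <;> linarith

end InCell

/-- The cone over the join of `[0, A]` and `[0, B]`. -/
def InJoin (A B : ℕ) (X : EuclideanSpace ℝ (Fin 4)) : Prop :=
  0 ≤ X 2 ∧ X 2 ≤ A * X 0 ∧ 0 ≤ X 3 ∧ X 3 ≤ B * X 1

section Grid

variable {A B : ℕ} {i j i' j' : ℕ} {X Y : EuclideanSpace ℝ (Fin 4)}

lemma InJoin.exists_inCell (hA : 0 < A) (hB : 0 < B) (hX : InJoin A B X) :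
    ∃ i < A, ∃ j < B, InCell i j X := by
  obtain ⟨h1, h2, h3, h4⟩ := hX
  obtain ⟨i, hi, h5, h6⟩ := exists_interval hA h1 h2
  obtain ⟨j, hj, h7, h8⟩ := exists_interval hB h3 h4
  exact ⟨i, hi, j, hj, h5, h6, h7, h8⟩

lemma InCell.inJoin (hi : i < A) (hj : j < B) (hX : InCell i j X) : InJoin A B X := by
  obtain ⟨h0, h0'⟩ := hX.nonneg
  obtain ⟨h1, h2, h3, h4⟩ := hX
  have hi' : (i : ℝ) + 1 ≤ A := by exact_mod_cast hi
  have hj' : (j : ℝ) + 1 ≤ B := by exact_mod_cast hj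
  exact ⟨(by positivity : (0 : ℝ) ≤ i * X 0).trans h1,
    h2.trans (mul_le_mul_of_nonneg_right hi' h0),
    (by positivity : (0 : ℝ) ≤ j * X 1).trans h3,
    h4.trans (mul_le_mul_of_nonneg_right hj' h0')⟩

/-- The grid vertices: the integer points of the two segments. -/
noncomputable def gridPoint : Fin (A + 1) ⊕ Fin (B + 1) → EuclideanSpace ℝ (Fin 4)
  | .inl r => !₂[1, 0, ((r : ℕ) : ℝ), 0]
  | .inr r => !₂[0, 1, 0, ((r : ℕ) : ℝ)]

lemma inCell_gridPoint_inl {r : Fin (A + 1)} :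
    InCell i j (gridPoint (B := B) (.inl r)) ↔ (r : ℕ) = i ∨ (r : ℕ) = i + 1 := by
  simp only [InCell, gridPoint]
  simp
  norm_cast
  omega

lemma inCell_gridPoint_inr {r : Fin (B + 1)} :
    InCell i j (gridPoint (A := A) (.inr r)) ↔ (r : ℕ) = j ∨ (r : ℕ) = j + 1 := by
  simp only [InCell, gridPoint]
  simp
  norm_cast
  omega

/-- The weighted sum of the grid vertices. -/
noncomputable def gridSum (w : Fin (A + 1) ⊕ Fin (B + 1) → ℝ) : EuclideanSpace ℝ (Fin 4) :=
  ∑ g, w g • gridPoint g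

variable {w w' : Fin (A + 1) ⊕ Fin (B + 1) → ℝ}

lemma gridSum_zero : gridSum w 0 = ∑ r, w (.inl r) := by
  simp [gridSum, gridPoint]

lemma gridSum_one : gridSum w 1 = ∑ r, w (.inr r) := by
  simp [gridSum, gridPoint]

lemma gridSum_two : gridSum w 2 = ∑ r, w (.inl r) * (r : ℕ) := by
  simp [gridSum, gridPoint]

lemma gridSum_three : gridSum w 3 = ∑ r, w (.inr r) * (r : ℕ) := by
  simp [gridSum, gridPoint]

lemma inCell_gridSum (hw : ∀ g, 0 ≤ w g) (hs : ∀ g, w g ≠ 0 → InCell i j (gridPoint g)) :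
    InCell i j (gridSum w) := by
  refine InCell.sum fun g _ => ?_
  by_cases h : w g = 0
  · simpa [h] using InCell.zero
  · exact (hs g h).smul (hw g)

lemma inCell_of_inCell_gridSum (hw : ∀ g, 0 ≤ w g)
    (hs : ∀ g, w g ≠ 0 → InCell i' j' (gridPoint g)) (h : InCell i j (gridSum w)) :
    ∀ g, w g ≠ 0 → InCell i j (gridPoint g) := by
  obtain ⟨h1, h2, h3, h4⟩ := h
  rw [gridSum_zero, gridSum_two] at h1 h2
  rw [gridSum_one, gridSum_three] at h3 h4
  rintro (r | r) hr
  · have hs' := fun r hr => inCell_gridPoint_inl.1 (hs (.inl r) hr)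
    rw [inCell_gridPoint_inl]
    have := le_of_weight_ne_zero (fun r => hw (.inl r)) hs' h1 hr
    have := weight_le_of_ne_zero (fun r => hw (.inl r)) hs' h2 hr
    omega
  · have hs' := fun r hr => inCell_gridPoint_inr.1 (hs (.inr r) hr)
    rw [inCell_gridPoint_inr]
    have := le_of_weight_ne_zero (fun r => hw (.inr r)) hs' h3 hr
    have := weight_le_of_ne_zero (fun r => hw (.inr r)) hs' h4 hr
    omega

lemma eq_of_gridSum_eq (hw : ∀ g, 0 ≤ w g) (hw' : ∀ g, 0 ≤ w' g)
    (hs : ∀ g, w g ≠ 0 → InCell i j (gridPoint g))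
    (hs' : ∀ g, w' g ≠ 0 → InCell i' j' (gridPoint g)) (h : gridSum w = gridSum w') : w = w' := by
  have hs'' := inCell_of_inCell_gridSum hw' hs' (h ▸ inCell_gridSum hw hs)
  have h0 := congrArg (fun X => X 0) h
  have h1 := congrArg (fun X => X 1) h
  have h2 := congrArg (fun X => X 2) h
  have h3 := congrArg (fun X => X 3) h
  simp only [gridSum_zero, gridSum_one, gridSum_two, gridSum_three] at h0 h1 h2 h3
  have hl := eq_of_sum_eq_of_sum_mul_eq (fun r hr => inCell_gridPoint_inl.1 (hs (.inl r) hr))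
    (fun r hr => inCell_gridPoint_inl.1 (hs'' (.inl r) hr)) h0 h2
  have hr := eq_of_sum_eq_of_sum_mul_eq (fun r hr => inCell_gridPoint_inr.1 (hs (.inr r) hr))
    (fun r hr => inCell_gridPoint_inr.1 (hs'' (.inr r) hr)) h1 h3
  funext g
  rcases g with r | r
  · exact congrFun hl r
  · exact congrFun hr r

lemma exists_gridSum_eq (hA : 0 < A) (hB : 0 < B) (hX : InJoin A B X) :
    ∃ w : Fin (A + 1) ⊕ Fin (B + 1) → ℝ, (∀ g, 0 ≤ w g) ∧ gridSum w = X ∧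
      ∀ i j, InCell i j X → ∀ g, w g ≠ 0 → InCell i j (gridPoint g) := by
  obtain ⟨i, hi, j, hj, hij⟩ := hX.exists_inCell hA hB
  obtain ⟨h1, h2, h3, h4⟩ := hij
  obtain ⟨u, hu, hus, hu0, hu1⟩ := exists_weights hi h1 h2
  obtain ⟨v, hv, hvs, hv0, hv1⟩ := exists_weights hj h3 h4
  have hw : ∀ g, 0 ≤ Sum.elim u v g := by rintro (r | r) <;> simp [hu, hv]
  have hsum : gridSum (Sum.elim u v) = X := by
    ext k
    fin_cases k
    · simpa [gridSum_zero] using hu0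
    · simpa [gridSum_one] using hv0
    · simpa [gridSum_two] using hu1
    · simpa [gridSum_three] using hv1
  have hs : ∀ g, Sum.elim u v g ≠ 0 → InCell i j (gridPoint g) := by
    rintro (r | r) hr
    · exact inCell_gridPoint_inl.2 (hus r hr)
    · exact inCell_gridPoint_inr.2 (hvs r hr)
  exact ⟨Sum.elim u v, hw, hsum, fun i' j' h =>
    inCell_of_inCell_gridSum hw hs (hsum.symm ▸ h)⟩

end Grid

/-- Disjoint staircase regions of cells in the `A × B` grid. Each region avoids the boundary of the
grid and is closed under moving towards its corner cell `(col b, row b)`, so that it is star-shaped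
with respect to an interior point of that cell. -/
structure StaircaseRegions (A B : ℕ) (ι : Type*) where
  Mem : ι → ℕ → ℕ → Prop
  col : ι → ℕ
  row : ι → ℕ
  A_pos : 0 < A
  B_pos : 0 < B
  corner_mem : ∀ b, Mem b (col b) (row b)
  col_lt : ∀ b, col b + 1 < A
  row_pos : ∀ b, 1 ≤ row b
  bounds : ∀ {b i j}, Mem b i j → 1 ≤ i ∧ i ≤ col b ∧ row b ≤ j ∧ j + 1 < B
  staircase : ∀ {b i j i' j'}, Mem b i j → i ≤ i' → i' ≤ col b → row b ≤ j' → j' ≤ j → Mem b i' j'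
  disjoint : ∀ {b b' i j}, Mem b i j → Mem b' i j → b = b'

namespace StaircaseRegions

variable {A B : ℕ} {ι : Type*} (R : StaircaseRegions A B ι) {b b' : ι} {i j i' j' : ℕ}
  {X Y : EuclideanSpace ℝ (Fin 4)} {c : ℝ}

/-- The cone point of a region. -/
noncomputable def apex (b : ι) : EuclideanSpace ℝ (Fin 4) :=
  !₂[1 / 2, 1 / 2, ((R.col b : ℝ) + 1 / 2) / 2, ((R.row b : ℝ) + 1 / 2) / 2]

/-- All cells of the grid that contain `X` belong to the region `b`. -/
def Surrounds (b : ι) (X : EuclideanSpace ℝ (Fin 4)) : Prop :=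
  ∀ i < A, ∀ j < B, InCell i j X → R.Mem b i j

lemma lt_of_mem (h : R.Mem b i j) : i < A ∧ j < B := by
  have h1 := R.col_lt b
  have h2 := R.bounds h
  omega

lemma inCell_apex : InCell (R.col b) (R.row b) (R.apex b) := by
  simp only [InCell, apex]
  simp
  refine ⟨?_, ?_, ?_, ?_⟩ <;> linarith

lemma inCell_zero_left (h0 : X 0 = 0) (h : InCell i j X) : InCell i' j X := by
  obtain ⟨h1, h2, h3, h4⟩ := h
  rw [h0] at h1 h2
  refine ⟨?_, ?_, h3, h4⟩ <;> rw [h0] <;> linarith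

lemma inCell_zero_right (h0 : X 1 = 0) (h : InCell i j X) : InCell i j' X := by
  obtain ⟨h1, h2, h3, h4⟩ := h
  rw [h0] at h3 h4
  refine ⟨h1, h2, ?_, ?_⟩ <;> rw [h0] <;> linarith

lemma surrounds_add (h : R.Mem b i j) (hX : InCell i j X) (hc : 0 < c) :
    R.Surrounds b (c • R.apex b + X) := by
  intro i' hi' j' hj' h'
  obtain ⟨hX0, hX1⟩ := hX.nonneg
  obtain ⟨h1, h2, h3, h4⟩ := hX
  obtain ⟨-, hb2, hb3, -⟩ := R.bounds h
  simp only [InCell, apex, PiLp.add_apply, PiLp.smul_apply, smul_eq_mul] at h'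
  simp at h'
  obtain ⟨h5, h6, h7, h8⟩ := h'
  have hb2' : (i : ℝ) ≤ R.col b := by exact_mod_cast hb2
  have hb3' : (R.row b : ℝ) ≤ j := by exact_mod_cast hb3
  refine R.staircase h ?_ ?_ ?_ ?_
  · by_contra! hlt
    have : (i' : ℝ) + 1 ≤ i := by exact_mod_cast hlt
    nlinarith
  · by_contra! hlt
    have : (R.col b : ℝ) + 1 ≤ i' := by exact_mod_cast hlt
    nlinarith
  · by_contra! hlt
    have : (j' : ℝ) + 1 ≤ R.row b := by exact_mod_cast hlt
    nlinarith
  · by_contra! hlt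
    have : (j : ℝ) + 1 ≤ j' := by exact_mod_cast hlt
    nlinarith

lemma eq_of_surrounds (hX : InJoin A B X) (h : R.Surrounds b X) (h' : R.Surrounds b' X) :
    b = b' := by
  obtain ⟨i, hi, j, hj, hij⟩ := hX.exists_inCell R.A_pos R.B_pos
  exact R.disjoint (h i hi j hj hij) (h' i hi j hj hij)

lemma inJoin_of_mem (h : R.Mem b i j) (hX : InCell i j X) : InJoin A B X :=
  hX.inJoin (R.lt_of_mem h).1 (R.lt_of_mem h).2

lemma isClosed_inCell (p : ℕ → ℕ → Prop) :
    IsClosed {X | ∃ i < A, ∃ j < B, p i j ∧ InCell i j X} := by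
  have : {X | ∃ i < A, ∃ j < B, p i j ∧ InCell i j X} =
      ⋃ ij ∈ {ij : ℕ × ℕ | ij ∈ Finset.range A ×ˢ Finset.range B ∧ p ij.1 ij.2},
        {X | InCell ij.1 ij.2 X} := by
    ext X
    simp only [Set.mem_ofPred_eq, Set.mem_iUnion, mem_product, mem_range, exists_prop, Prod.exists]
    constructor
    · rintro ⟨i, hi, j, hj, hp, h⟩
      exact ⟨i, j, ⟨⟨hi, hj⟩, hp⟩, h⟩
    · rintro ⟨i, j, ⟨⟨hi, hj⟩, hp⟩, h⟩
      exact ⟨i, hi, j, hj, hp, h⟩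
  rw [this]
  exact Set.Finite.isClosed_biUnion
    ((Finset.range A ×ˢ Finset.range B).finite_toSet.subset fun _ h => h.1)
    fun ij _ => InCell.isClosed _ _

/-- Points near a surrounded point remain in the region. -/
lemma eventually_mem (h : R.Mem b i j) (hX : InCell i j X) (hs : R.Surrounds b X) :
    ∀ᶠ Y in nhds X, ∃ i < A, ∃ j < B, R.Mem b i j ∧ InCell i j Y := by
  have hF := (isClosed_inCell (A := A) (B := B) fun i j => ¬ R.Mem b i j).isOpen_compl.mem_nhds
    (x := X) (by
      rintro ⟨i, hi, j, hj, hp, h⟩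
      exact hp (hs i hi j hj h))
  obtain ⟨hX0, hX1⟩ := hX.nonneg
  obtain ⟨hb1, hb2, hb3, hb4⟩ := R.bounds h
  have hcol := R.col_lt b
  have hrow := R.row_pos b
  have h0 : 0 < X 0 := hX0.lt_of_ne fun h0 => by
    have := (R.bounds (hs 0 (by omega) j (by omega) (inCell_zero_left h0.symm hX))).1
    omega
  have h1 : 0 < X 1 := hX1.lt_of_ne fun h1 => by
    have := (R.bounds (hs i (by omega) 0 (by omega) (inCell_zero_right h1.symm hX))).2.2.1
    omega
  obtain ⟨h2, h3, h4, h5⟩ := hX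
  have hi : (1 : ℝ) ≤ i := by exact_mod_cast hb1
  have hi' : (i : ℝ) + 1 < A := by exact_mod_cast (by omega : i + 1 < A)
  have hj : (1 : ℝ) ≤ j := by exact_mod_cast (by omega : 1 ≤ j)
  have hj' : (j : ℝ) + 1 < B := by exact_mod_cast hb4
  have e1 : ∀ᶠ Y : EuclideanSpace ℝ (Fin 4) in nhds X, 0 < Y 2 :=
    (isOpen_lt (by fun_prop) (by fun_prop)).mem_nhds
      (show (0 : ℝ) < X 2 by nlinarith)
  have e2 : ∀ᶠ Y : EuclideanSpace ℝ (Fin 4) in nhds X, Y 2 < A * Y 0 :=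
    (isOpen_lt (by fun_prop) (by fun_prop)).mem_nhds
      (show X 2 < A * X 0 by nlinarith)
  have e3 : ∀ᶠ Y : EuclideanSpace ℝ (Fin 4) in nhds X, 0 < Y 3 :=
    (isOpen_lt (by fun_prop) (by fun_prop)).mem_nhds
      (show (0 : ℝ) < X 3 by nlinarith)
  have e4 : ∀ᶠ Y : EuclideanSpace ℝ (Fin 4) in nhds X, Y 3 < B * Y 1 :=
    (isOpen_lt (by fun_prop) (by fun_prop)).mem_nhds
      (show X 3 < B * X 1 by nlinarith)
  filter_upwards [hF, e1, e2, e3, e4] with Y hY hY1 hY2 hY3 hY4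
  obtain ⟨i', hi', j', hj', hij⟩ := InJoin.exists_inCell (A := A) (B := B) R.A_pos R.B_pos
    ⟨hY1.le, hY2.le, hY3.le, hY4.le⟩
  refine ⟨i', hi', j', hj', ?_, hij⟩
  by_contra hm
  exact hY ⟨i', hi', j', hj', hm, hij⟩

/-- A point surrounded by a region lies on a segment from the apex to a wall of the region. -/
lemma exists_eq_smul_apex_add (hX : InJoin A B X) (hs : R.Surrounds b X) :
    ∃ c : ℝ, 0 ≤ c ∧ ∃ Y, X = c • R.apex b + Y ∧ ¬ R.Surrounds b Y ∧
      ∃ i j, R.Mem b i j ∧ InCell i j Y := by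
  set U : Set (EuclideanSpace ℝ (Fin 4)) := {X | ∃ i < A, ∃ j < B, R.Mem b i j ∧ InCell i j X}
    with hU
  set f : ℝ → EuclideanSpace ℝ (Fin 4) := fun c => X - c • R.apex b with hf
  have hfc : Continuous f := by fun_prop
  have hfb : ∀ c, f c ∈ U → c ≤ 2 * X 0 := by
    rintro c ⟨i, -, j, -, -, h⟩
    have := h.nonneg.1
    simp [f, apex] at this
    linarith
  have hcpt : IsCompact (Set.Icc 0 (2 * X 0) ∩ f ⁻¹' U) :=
    isCompact_Icc.inter_right ((isClosed_inCell _).preimage hfc)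
  obtain ⟨i, hi, j, hj, hij⟩ := hX.exists_inCell R.A_pos R.B_pos
  have h0U : f 0 ∈ U := by
    rw [show f 0 = X by simp [f]]
    exact ⟨i, hi, j, hj, hs i hi j hj hij, hij⟩
  obtain ⟨c, ⟨hc, hcU⟩, hmax⟩ := hcpt.exists_isMaxOn
    ⟨0, ⟨le_rfl, by simpa using hfb 0 h0U⟩, h0U⟩ continuousOn_id
  obtain ⟨i', -, j', -, hm, hY⟩ := id hcU
  refine ⟨c, hc.1, f c, by simp [f], fun hsur => ?_, i', j', hm, hY⟩
  have hev := hfc.continuousAt.eventually (R.eventually_mem hm hY hsur)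
  obtain ⟨ε, hε, hball⟩ := Metric.eventually_nhds_iff.1 hev
  have hmem : f (c + ε / 2) ∈ U := hball (by
    rw [Real.dist_eq, add_sub_cancel_left, abs_of_pos (by linarith)]
    linarith)
  have := hmax ⟨⟨by linarith [hc.1], hfb _ hmem⟩, hmem⟩
  simp only [id, Set.mem_ofPred_eq] at this
  linarith

end StaircaseRegions

section Body

variable {A B : ℕ} {X Y : EuclideanSpace ℝ (Fin 4)} {c : ℝ}

/-- The linear functionals cutting out the cone over the join of `[0, A]` and `[0, B]`. -/
noncomputable def wall (A B : ℕ) : Fin 4 → EuclideanSpace ℝ (Fin 4) →L[ℝ] ℝ :=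
  ![EuclideanSpace.proj 2, (A : ℝ) • EuclideanSpace.proj 0 - EuclideanSpace.proj 2,
    EuclideanSpace.proj 3, (B : ℝ) • EuclideanSpace.proj 1 - EuclideanSpace.proj 3]

/-- The functional that equals `1` on the hyperplane containing the join. -/
noncomputable def mass : EuclideanSpace ℝ (Fin 4) →L[ℝ] ℝ :=
  EuclideanSpace.proj 0 + EuclideanSpace.proj 1

lemma inJoin_iff : InJoin A B X ↔ ∀ k, 0 ≤ wall A B k X := by
  simp [InJoin, wall, Fin.forall_fin_succ]

lemma InJoin.add (hX : InJoin A B X) (hY : InJoin A B Y) : InJoin A B (X + Y) := by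
  rw [inJoin_iff] at *
  intro k
  rw [map_add]
  exact add_nonneg (hX k) (hY k)

lemma InJoin.smul (hc : 0 ≤ c) (hX : InJoin A B X) : InJoin A B (c • X) := by
  rw [inJoin_iff] at *
  intro k
  rw [map_smul]
  exact mul_nonneg hc (hX k)

/-- The `4`-simplex spanned by the origin and the join of the segments `[0, A]` and `[0, B]`. -/
def body (A B : ℕ) : Set (EuclideanSpace ℝ (Fin 4)) := {X | InJoin A B X ∧ mass X ≤ 1}

lemma body_eq : body A B = (⋂ k, wall A B k ⁻¹' Set.Ici 0) ∩ mass ⁻¹' Set.Iic 1 := by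
  ext X
  simp [body, inJoin_iff]

lemma convex_body : Convex ℝ (body A B) := by
  rw [body_eq]
  exact (convex_iInter fun k => (convex_Ici 0).linear_preimage (wall A B k).toLinearMap).inter
    ((convex_Iic 1).linear_preimage mass.toLinearMap)

lemma isClosed_body : IsClosed (body A B) := by
  rw [body_eq]
  exact (isClosed_iInter fun k => isClosed_Ici.preimage (wall A B k).continuous).inter
    (isClosed_Iic.preimage mass.continuous)

lemma isOpenMap_of_apply_ne_zero (f : EuclideanSpace ℝ (Fin 4) →L[ℝ] ℝ) (h : f X ≠ 0) :
    IsOpenMap f :=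
  f.isOpenMap fun y => ⟨(y / f X) • X, by simp [h]⟩

lemma interior_body (hA : 0 < A) (hB : 0 < B) :
    interior (body A B) = (⋂ k, wall A B k ⁻¹' Set.Ioi 0) ∩ mass ⁻¹' Set.Iio 1 := by
  have hA' : (A : ℝ) ≠ 0 := by positivity
  have hB' : (B : ℝ) ≠ 0 := by positivity
  have hw : ∀ k, IsOpenMap (wall A B k) := by
    intro k
    fin_cases k
    · exact isOpenMap_of_apply_ne_zero _ (X := !₂[0, 0, 1, 0]) (by simp [wall])
    · exact isOpenMap_of_apply_ne_zero _ (X := !₂[1, 0, 0, 0]) (by simp [wall, hA'])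
    · exact isOpenMap_of_apply_ne_zero _ (X := !₂[0, 0, 0, 1]) (by simp [wall])
    · exact isOpenMap_of_apply_ne_zero _ (X := !₂[0, 1, 0, 0]) (by simp [wall, hB'])
  have hm : IsOpenMap mass := isOpenMap_of_apply_ne_zero _ (X := !₂[1, 0, 0, 0]) (by simp [mass])
  rw [body_eq, interior_inter, interior_iInter_of_finite,
    ← hm.preimage_interior_eq_interior_preimage mass.continuous, interior_Iic]
  simp_rw [← (hw _).preimage_interior_eq_interior_preimage (wall A B _).continuous, interior_Ici]

lemma mem_frontier_body (hA : 0 < A) (hB : 0 < B) : X ∈ frontier (body A B) ↔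
    InJoin A B X ∧ mass X ≤ 1 ∧ (mass X = 1 ∨ ∃ k, wall A B k X = 0) := by
  rw [isClosed_body.frontier_eq, interior_body hA hB, Set.mem_sdiff, body,
    Set.mem_ofPred_eq, and_assoc]
  refine and_congr_right fun h1 => and_congr_right fun h2 => ?_
  rw [inJoin_iff] at h1
  simp only [Set.mem_inter_iff, Set.mem_iInter, Set.mem_preimage, Set.mem_Ioi, Set.mem_Iio]
  constructor
  · intro h
    by_contra! hne
    exact h ⟨fun k => (h1 k).lt_of_ne (hne.2 k).symm, h2.lt_of_ne hne.1⟩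
  · rintro (h | ⟨k, hk⟩) ⟨h3, h4⟩
    · exact h4.ne h
    · exact (h3 k).ne' hk

lemma isBounded_body (hA : 0 < A) (hB : 0 < B) : Bornology.IsBounded (body A B) := by
  refine (Metric.isBounded_closedBall (x := 0) (r := √(1 + 1 + A ^ 2 + B ^ 2))).subset ?_
  rintro X ⟨⟨h1, h2, h3, h4⟩, h5⟩
  rw [mem_closedBall_zero_iff, EuclideanSpace.norm_eq]
  refine Real.sqrt_le_sqrt ?_
  simp [mass] at h5
  simp only [Fin.sum_univ_four, Real.norm_eq_abs, sq_abs]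
  have hA' : (0 : ℝ) < A := by positivity
  have hB' : (0 : ℝ) < B := by positivity
  have h0 : 0 ≤ X 0 := nonneg_of_mul_nonneg_right (h1.trans h2) hA'
  have h0' : 0 ≤ X 1 := nonneg_of_mul_nonneg_right (h3.trans h4) hB'
  have h6 : X 2 ≤ A := h2.trans (mul_le_of_le_one_right hA'.le (by linarith))
  have h7 : X 3 ≤ B := h4.trans (mul_le_of_le_one_right hB'.le (by linarith))
  gcongr
  · exact pow_le_one₀ h0 (by linarith)
  · exact pow_le_one₀ h0' (by linarith)

lemma nonempty_interior_body (hA : 0 < A) (hB : 0 < B) : (interior (body A B)).Nonempty := by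
  rw [interior_body hA hB]
  have hA' : (0 : ℝ) < A := by positivity
  have hB' : (0 : ℝ) < B := by positivity
  refine ⟨!₂[1 / 4, 1 / 4, A / 8, B / 8], ?_, ?_⟩
  · simp [wall, Fin.forall_fin_succ]
    refine ⟨?_, ?_, ?_, ?_⟩ <;> linarith
  · simp [mass]
    norm_num

lemma nonempty_frontier_body_homeomorph (hA : 0 < A) (hB : 0 < B) :
    Nonempty (frontier (body A B) ≃ₜ
      (Metric.sphere (0 : EuclideanSpace ℝ (Fin 4)) 1 : Set (EuclideanSpace ℝ (Fin 4)))) := by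
  obtain ⟨h, -, -, hf⟩ := exists_homeomorph_image_interior_closure_frontier_eq_unitBall
    (convex_body (A := A) (B := B)) (nonempty_interior_body hA hB) (isBounded_body hA hB)
  exact ⟨(h.image _).trans (Homeomorph.setCongr hf)⟩

end Body

namespace StaircaseRegions

variable {A B : ℕ} {ι : Type*} (R : StaircaseRegions A B ι)

/-- Vertices of the triangulated sphere: the origin, the cone points of the regions, and the grid
vertices. -/
abbrev Vertex (A B : ℕ) (ι : Type*) := Option (ι ⊕ (Fin (A + 1) ⊕ Fin (B + 1)))

/-- The position of each vertex in `ℝ⁴`. -/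
noncomputable def pos : Vertex A B ι → EuclideanSpace ℝ (Fin 4)
  | none => 0
  | some (.inl b) => R.apex b
  | some (.inr g) => gridPoint g

/-- All grid vertices of `S` lie in the cell `(i, j)`. -/
def GridInCell (i j : ℕ) (S : Finset (Vertex A B ι)) : Prop :=
  ∀ g, some (.inr g) ∈ S → InCell i j (gridPoint g)

/-- The faces of the triangulated sphere: those grid simplices that are not interior to a region, cones
over the ones in the boundary of a region, and cones with apex the origin over the ones in the
boundary of the grid. -/
structure IsFace (S : Finset (Vertex A B ι)) : Prop where
  cell : ∃ i < A, ∃ j < B, GridInCell i j S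
  retained : ∀ b, ∃ i < A, ∃ j < B, ¬ R.Mem b i j ∧ GridInCell i j S
  cone : ∀ b, some (.inl b) ∈ S → ∃ i j, R.Mem b i j ∧ GridInCell i j S
  apex_unique : ∀ b b', some (.inl b) ∈ S → some (.inl b') ∈ S → b = b'
  outer : none ∈ S → (∀ b, some (.inl b) ∉ S) ∧
    ∃ k, ∀ g, some (.inr g) ∈ S → wall A B k (gridPoint g) = 0

lemma IsFace.mono {S T : Finset (Vertex A B ι)} (hT : R.IsFace T) (h : S ⊆ T) : R.IsFace S where
  cell := by
    obtain ⟨i, hi, j, hj, hc⟩ := hT.cell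
    exact ⟨i, hi, j, hj, fun g hg => hc g (h hg)⟩
  retained b := by
    obtain ⟨i, hi, j, hj, hm, hc⟩ := hT.retained b
    exact ⟨i, hi, j, hj, hm, fun g hg => hc g (h hg)⟩
  cone b hb := by
    obtain ⟨i, j, hm, hc⟩ := hT.cone b (h hb)
    exact ⟨i, j, hm, fun g hg => hc g (h hg)⟩
  apex_unique b b' hb hb' := hT.apex_unique b b' (h hb) (h hb')
  outer hn := by
    obtain ⟨h1, k, hk⟩ := hT.outer (h hn)
    exact ⟨fun b hb => h1 b (h hb), k, fun g hg => hk g (h hg)⟩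

lemma not_mem_zero_left (b : ι) (j : ℕ) : ¬ R.Mem b 0 j := fun h => by
  have := R.bounds h
  omega

lemma not_mem_zero_right (b : ι) (i : ℕ) : ¬ R.Mem b i 0 := fun h => by
  have := R.bounds h
  have := R.row_pos b
  omega

lemma isFace_singleton (v : Vertex A B ι) : R.IsFace {v} := by
  have hA := R.A_pos
  have hB := R.B_pos
  have key : ∃ i < A, ∃ j < B, (∀ b, ¬ R.Mem b i j) ∧ GridInCell i j {v} := by
    rcases v with _ | b | r | r
    · exact ⟨0, hA, 0, hB, fun b => R.not_mem_zero_left b 0, fun g hg => by simp at hg⟩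
    · exact ⟨0, hA, 0, hB, fun b => R.not_mem_zero_left b 0, fun g hg => by simp at hg⟩
    · refine ⟨min r (A - 1), by omega, 0, hB, fun b => R.not_mem_zero_right b _, fun g hg => ?_⟩
      simp only [mem_singleton, Option.some.injEq, Sum.inr.injEq] at hg
      rw [hg, inCell_gridPoint_inl]
      omega
    · refine ⟨0, hA, min r (B - 1), by omega, fun b => R.not_mem_zero_left b _, fun g hg => ?_⟩
      simp only [mem_singleton, Option.some.injEq, Sum.inr.injEq] at hg
      rw [hg, inCell_gridPoint_inr]
      omega
  obtain ⟨i, hi, j, hj, hm, hc⟩ := key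
  refine ⟨⟨i, hi, j, hj, hc⟩, fun b => ⟨i, hi, j, hj, hm b, hc⟩, fun b hb => ?_, fun b b' hb hb' => ?_,
    fun hn => ?_⟩
  · rw [mem_singleton] at hb
    exact ⟨_, _, R.corner_mem b, fun g hg => by simp [← hb] at hg⟩
  · rw [mem_singleton] at hb hb'
    simpa using hb.trans hb'.symm
  · rw [mem_singleton] at hn
    exact ⟨fun b hb => by simp [← hn] at hb, 0, fun g hg => by simp [← hn] at hg⟩

/-- The part of a weighted sum carried by the grid vertices. -/
noncomputable def gridPart (w : Vertex A B ι → ℝ) : EuclideanSpace ℝ (Fin 4) :=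
  gridSum fun g => w (some (.inr g))

lemma mass_gridSum (w : Fin (A + 1) ⊕ Fin (B + 1) → ℝ) : mass (gridSum w) = ∑ g, w g := by
  simp [mass, gridSum_zero, gridSum_one, Fintype.sum_sum_type]

lemma mass_apex (b : ι) : mass (R.apex b) = 1 := by
  simp [mass, apex]
  norm_num

variable [Fintype ι]

lemma sum_smul_pos (w : Vertex A B ι → ℝ) :
    ∑ v, w v • R.pos v = ∑ b, w (some (.inl b)) • R.apex b + gridPart w := by
  simp [Fintype.sum_option, Fintype.sum_sum_type, gridPart, gridSum, pos]

lemma mass_sum_smul_pos (w : Vertex A B ι → ℝ) :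
    mass (∑ v, w v • R.pos v) = ∑ v, w v - w none := by
  rw [sum_smul_pos, map_add, map_sum, gridPart, mass_gridSum, Fintype.sum_option,
    Fintype.sum_sum_type]
  simp [mass_apex]

variable {w w' : Vertex A B ι → ℝ} {S S' : Finset (Vertex A B ι)} {b b' : ι} {i j : ℕ}

omit [Fintype ι] in
lemma inCell_gridPart (hw : ∀ v, 0 ≤ w v) (hs : ∀ v, w v ≠ 0 → v ∈ S) (h : GridInCell i j S) :
    InCell i j (gridPart w) :=
  inCell_gridSum (fun _ => hw _) fun g hg => h g (hs _ hg)

omit [Fintype ι] in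
lemma IsFace.not_surrounds_gridPart (hS : R.IsFace S) (hw : ∀ v, 0 ≤ w v)
    (hs : ∀ v, w v ≠ 0 → v ∈ S) (b : ι) : ¬ R.Surrounds b (gridPart w) := by
  obtain ⟨i, hi, j, hj, hm, hc⟩ := hS.retained b
  exact fun h => hm (h i hi j hj (inCell_gridPart hw hs hc))

lemma IsFace.sum_smul_pos_eq (hS : R.IsFace S) (hs : ∀ v, w v ≠ 0 → v ∈ S)
    (hb : w (some (.inl b)) ≠ 0) :
    ∑ v, w v • R.pos v = w (some (.inl b)) • R.apex b + gridPart w := by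
  rw [sum_smul_pos, sum_eq_single b]
  · intro b' _ hb'
    by_contra h
    exact hb' (hS.apex_unique _ _ (hs _ fun h0 => h (by rw [h0, zero_smul])) (hs _ hb))
  · simp

lemma sum_smul_pos_eq_gridPart (h : ∀ b, w (some (.inl b)) = 0) :
    ∑ v, w v • R.pos v = gridPart w := by
  rw [sum_smul_pos]
  simp [h]

omit [Fintype ι] in
lemma inJoin_apex (b : ι) : InJoin A B (R.apex b) :=
  R.inJoin_of_mem (R.corner_mem b) R.inCell_apex

omit [Fintype ι] in
lemma IsFace.inJoin_gridPart (hS : R.IsFace S) (hw : ∀ v, 0 ≤ w v) (hs : ∀ v, w v ≠ 0 → v ∈ S) :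
    InJoin A B (gridPart w) := by
  obtain ⟨i, hi, j, hj, hc⟩ := hS.cell
  exact (inCell_gridPart hw hs hc).inJoin hi hj

lemma IsFace.inJoin_sum (hS : R.IsFace S) (hw : ∀ v, 0 ≤ w v) (hs : ∀ v, w v ≠ 0 → v ∈ S) :
    InJoin A B (∑ v, w v • R.pos v) := by
  by_cases h : ∀ b, w (some (.inl b)) = 0
  · rw [R.sum_smul_pos_eq_gridPart h]
    exact hS.inJoin_gridPart R hw hs
  · push Not at h
    obtain ⟨b, hb⟩ := h
    rw [hS.sum_smul_pos_eq R hs hb]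
    exact ((R.inJoin_apex b).smul (hw _)).add (hS.inJoin_gridPart R hw hs)

lemma IsFace.surrounds_iff (hS : R.IsFace S) (hw : ∀ v, 0 ≤ w v) (hs : ∀ v, w v ≠ 0 → v ∈ S)
    (b : ι) : R.Surrounds b (∑ v, w v • R.pos v) ↔ w (some (.inl b)) ≠ 0 := by
  have key : ∀ b, w (some (.inl b)) ≠ 0 → R.Surrounds b (∑ v, w v • R.pos v) := by
    intro b hb
    obtain ⟨i, j, hm, hc⟩ := hS.cone b (hs _ hb)
    rw [hS.sum_smul_pos_eq R hs hb]
    exact R.surrounds_add hm (inCell_gridPart hw hs hc) ((hw _).lt_of_ne hb.symm)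
  refine ⟨fun h => ?_, key b⟩
  by_cases h0 : ∀ b, w (some (.inl b)) = 0
  · rw [R.sum_smul_pos_eq_gridPart h0] at h
    exact absurd h (hS.not_surrounds_gridPart R hw hs b)
  · push Not at h0
    obtain ⟨b', hb'⟩ := h0
    rwa [R.eq_of_surrounds (hS.inJoin_sum R hw hs) h (key b' hb')]

lemma weight_le_of_sum_eq (hS : R.IsFace S) (hS' : R.IsFace S')
    (hw : ∀ v, 0 ≤ w v) (hw' : ∀ v, 0 ≤ w' v) (hs : ∀ v, w v ≠ 0 → v ∈ S)
    (hs' : ∀ v, w' v ≠ 0 → v ∈ S') (hb : w (some (.inl b)) ≠ 0) (hb' : w' (some (.inl b)) ≠ 0)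
    (h : ∑ v, w v • R.pos v = ∑ v, w' v • R.pos v) :
    w (some (.inl b)) ≤ w' (some (.inl b)) := by
  by_contra! hlt
  rw [hS.sum_smul_pos_eq R hs hb, hS'.sum_smul_pos_eq R hs' hb'] at h
  obtain ⟨i, j, hm, hc⟩ := hS.cone b (hs _ hb)
  have := R.surrounds_add hm (inCell_gridPart hw hs hc) (sub_pos.2 hlt)
  refine hS'.not_surrounds_gridPart R hw' hs' b ?_
  convert this using 1
  rw [sub_smul, sub_add_eq_add_sub, h, add_sub_cancel_left]

/-- The triangulated sphere determined by a family of staircase regions. -/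
noncomputable def toPlacedComplex : PlacedComplex (Vertex A B ι) (EuclideanSpace ℝ (Fin 4)) where
  pos := R.pos
  IsFace := R.IsFace
  mono := IsFace.mono R
  singleton := R.isFace_singleton
  unique := by
    intro w w' S S' hS hS' hw hw' hs hs' hm h
    have hnone : w none = w' none := by
      have := congrArg mass h
      rw [mass_sum_smul_pos, mass_sum_smul_pos, hm] at this
      linarith
    have hiff : ∀ b, w (some (.inl b)) ≠ 0 ↔ w' (some (.inl b)) ≠ 0 := fun b => by
      rw [← hS.surrounds_iff R hw hs, ← hS'.surrounds_iff R hw' hs', h]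
    have hapex : ∀ b, w (some (.inl b)) = w' (some (.inl b)) := fun b => by
      by_cases hb : w (some (.inl b)) = 0
      · rw [hb, not_ne_iff.1 (mt (hiff b).2 (not_ne_iff.2 hb))]
      · exact le_antisymm (R.weight_le_of_sum_eq hS hS' hw hw' hs hs' hb ((hiff b).1 hb) h)
          (R.weight_le_of_sum_eq hS' hS hw' hw hs' hs ((hiff b).1 hb) hb h.symm)
    have hgrid : gridPart w = gridPart w' := by
      rw [sum_smul_pos, sum_smul_pos] at h
      simpa [hapex] using h
    obtain ⟨i, -, j, -, hc⟩ := hS.cell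
    obtain ⟨i', -, j', -, hc'⟩ := hS'.cell
    have := eq_of_gridSum_eq (fun g => hw _) (fun g => hw' _) (fun g hg => hc g (hs _ hg))
      (fun g hg => hc' g (hs' _ hg)) hgrid
    funext v
    rcases v with _ | b | g
    · exact hnone
    · exact hapex b
    · exact congrFun this g

end StaircaseRegions

namespace StaircaseRegions

variable {A B : ℕ} {ι : Type*} (R : StaircaseRegions A B ι) {b : ι} {k : Fin 4}
  {X Y : EuclideanSpace ℝ (Fin 4)}

lemma not_surrounds_of_wall_eq_zero (hX : InJoin A B X) (hk : wall A B k X = 0) (b : ι) :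
    ¬ R.Surrounds b X := by
  intro hs
  have hA := R.A_pos
  have hB := R.B_pos
  obtain ⟨i, hi, j, hj, hij⟩ := hX.exists_inCell hA hB
  obtain ⟨hX0, hX1⟩ := hij.nonneg
  obtain ⟨h1, h2, h3, h4⟩ := hij
  have hA' : ((A - 1 : ℕ) : ℝ) = A - 1 := by rw [Nat.cast_sub hA, Nat.cast_one]
  have hB' : ((B - 1 : ℕ) : ℝ) = B - 1 := by rw [Nat.cast_sub hB, Nat.cast_one]
  fin_cases k <;> simp [wall] at hk
  · refine R.not_mem_zero_left b j (hs 0 hA j hj ⟨?_, ?_, h3, h4⟩) <;> simp [hk, hX0]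
  · have := R.bounds (hs (A - 1) (by omega) j hj ⟨?_, ?_, h3, h4⟩)
    · have := R.col_lt b
      omega
    · rw [hA']
      linarith
    · rw [hA']
      linarith
  · refine R.not_mem_zero_right b i (hs i hi 0 hB ⟨h1, h2, ?_, ?_⟩) <;> simp [hk, hX1]
  · have := R.bounds (hs i hi (B - 1) (by omega) ⟨h1, h2, ?_, ?_⟩)
    · omega
    · rw [hB']
      linarith
    · rw [hB']
      linarith

lemma inJoin_gridPoint (g : Fin (A + 1) ⊕ Fin (B + 1)) : InJoin A B (gridPoint g) := by
  rcases g with r | r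
  · simp only [InJoin, gridPoint]
    simpa using Nat.lt_succ_iff.1 r.2
  · simp only [InJoin, gridPoint]
    simpa using Nat.lt_succ_iff.1 r.2

lemma map_gridSum (f : EuclideanSpace ℝ (Fin 4) →L[ℝ] ℝ) (v : Fin (A + 1) ⊕ Fin (B + 1) → ℝ) :
    f (gridSum v) = ∑ g, v g * f (gridPoint g) := by
  simp [gridSum]

variable [Fintype ι] [DecidableEq ι]

lemma mem_space_of_decomposition (hY : InJoin A B Y) (hs : ∀ b, ¬ R.Surrounds b Y) {f : ι → ℝ} {t : ℝ}
    (hf : ∀ b, 0 ≤ f b) (ht : 0 ≤ t)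
    (hcone : ∀ b, f b ≠ 0 → ∃ i j, R.Mem b i j ∧ InCell i j Y)
    (huniq : ∀ b b', f b ≠ 0 → f b' ≠ 0 → b = b')
    (hout : t ≠ 0 → (∀ b, f b = 0) ∧ ∃ k, wall A B k Y = 0) (hsum : t + ∑ b, f b + mass Y = 1) :
    ∑ b, f b • R.apex b + Y ∈ R.toPlacedComplex.toSimplicialComplex.space := by
  classical
  obtain ⟨v, hv, rfl, hcell⟩ := exists_gridSum_eq R.A_pos R.B_pos hY
  let w : Vertex A B ι → ℝ := fun x => x.elim t (Sum.elim f v)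
  have hw : ∀ x, 0 ≤ w x := by
    rintro (_ | b | g)
    · exact ht
    · exact hf b
    · exact hv g
  rw [PlacedComplex.mem_space]
  refine ⟨w, univ.filter (w · ≠ 0), ?_, hw, fun x hx => by simpa using hx, ?_, ?_⟩
  · refine ⟨?_, fun b => ?_, fun b hb => ?_, fun b b' hb hb' => ?_, fun hn => ?_⟩
    · obtain ⟨i, hi, j, hj, hij⟩ := hY.exists_inCell R.A_pos R.B_pos
      exact ⟨i, hi, j, hj, fun g hg => hcell i j hij g (mem_filter.1 hg).2⟩
    · have := hs b
      simp only [Surrounds, not_forall] at this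
      obtain ⟨i, hi, j, hj, hij, hm⟩ := this
      exact ⟨i, hi, j, hj, hm, fun g hg => hcell i j hij g (mem_filter.1 hg).2⟩
    · obtain ⟨i, j, hm, hij⟩ := hcone b (mem_filter.1 hb).2
      exact ⟨i, j, hm, fun g hg => hcell i j hij g (mem_filter.1 hg).2⟩
    · exact huniq b b' (mem_filter.1 hb).2 (mem_filter.1 hb').2
    · obtain ⟨h1, k, hk⟩ := hout (mem_filter.1 hn).2
      refine ⟨fun b hb => (mem_filter.1 hb).2 (h1 b), k, fun g hg => ?_⟩
      rw [map_gridSum, sum_eq_zero_iff_of_nonneg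
        fun g _ => mul_nonneg (hv g) (inJoin_iff.1 (inJoin_gridPoint g) k)] at hk
      exact (mul_eq_zero.1 (hk g (mem_univ _))).resolve_left (mem_filter.1 hg).2
  · rw [mass_gridSum] at hsum
    simpa [Fintype.sum_option, Fintype.sum_sum_type, w, add_assoc] using hsum
  · exact R.sum_smul_pos w

lemma space_eq : R.toPlacedComplex.toSimplicialComplex.space = frontier (body A B) := by
  ext X
  rw [mem_frontier_body R.A_pos R.B_pos]
  constructor
  · rw [PlacedComplex.mem_space]
    rintro ⟨w, S, hS, hw, hs, h1, rfl⟩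
    change InJoin A B (∑ v, w v • R.pos v) ∧ mass (∑ v, w v • R.pos v) ≤ 1 ∧
      (mass (∑ v, w v • R.pos v) = 1 ∨ ∃ k, wall A B k (∑ v, w v • R.pos v) = 0)
    have hm := R.mass_sum_smul_pos w
    rw [h1] at hm
    refine ⟨hS.inJoin_sum R hw hs, by linarith [hw none], ?_⟩
    by_cases h0 : w none = 0
    · left
      linarith
    · obtain ⟨hb, k, hk⟩ := hS.outer (hs _ h0)
      refine .inr ⟨k, ?_⟩
      rw [R.sum_smul_pos_eq_gridPart fun b => not_ne_iff.1 (mt (hs _) (hb b)), gridPart, map_gridSum]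
      refine sum_eq_zero fun g _ => ?_
      by_cases hg : w (some (.inr g)) = 0
      · rw [hg, zero_mul]
      · rw [hk g (hs _ hg), mul_zero]
  · rintro ⟨hX, hm, h⟩
    by_cases hs : ∃ b, R.Surrounds b X
    · obtain ⟨b, hs⟩ := hs
      have h1 : mass X = 1 := h.resolve_right fun ⟨k, hk⟩ =>
        R.not_surrounds_of_wall_eq_zero hX hk b hs
      obtain ⟨c, hc, Y, rfl, hY, i, j, hij, hijY⟩ := R.exists_eq_smul_apex_add hX hs
      have hlt := R.lt_of_mem hij
      have := R.mem_space_of_decomposition (f := Pi.single b c) (t := 0) (R.inJoin_of_mem hij hijY)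
        (fun b' hb' => hY (R.disjoint hij (hb' i hlt.1 j hlt.2 hijY) ▸ hb'))
        (fun b' => by rw [Pi.single_apply]; split_ifs <;> simp [hc]) le_rfl ?_ ?_ (by simp) ?_
      · simpa [Pi.single_apply, ite_smul] using this
      · intro b' hb'
        obtain rfl : b' = b := by
          by_contra hne
          exact hb' (Pi.single_eq_of_ne hne _)
        exact ⟨i, j, hij, hijY⟩
      · have : ∀ b', (Pi.single b c : ι → ℝ) b' ≠ 0 → b' = b := fun b' hb' => by
          by_contra hne
          exact hb' (Pi.single_eq_of_ne hne _)
        exact fun b₁ b₂ h₁ h₂ => (this b₁ h₁).trans (this b₂ h₂).symm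
      · simpa [mass_apex] using h1
    · push Not at hs
      have := R.mem_space_of_decomposition (f := 0) (t := 1 - mass X) hX hs (by simp) (by linarith)
        (by simp) (by simp) (fun h0 => ⟨by simp, h.resolve_left fun h1 => h0 (by linarith)⟩)
        (by simp)
      simpa using this

end StaircaseRegions

namespace StaircaseRegions

variable {A B i j i' j' : ℕ} {ι : Type*} [DecidableEq ι]

/-- The four grid vertices of the cell `(i, j)`. -/
def cellVertices (ι : Type*) [DecidableEq ι] (hi : i < A) (hj : j < B) : Finset (Vertex A B ι) :=
  {some (.inr (.inl ⟨i, by omega⟩)), some (.inr (.inl ⟨i + 1, by omega⟩)),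
    some (.inr (.inr ⟨j, by omega⟩)), some (.inr (.inr ⟨j + 1, by omega⟩))}

lemma gridInCell_cellVertices (hi : i < A) (hj : j < B) :
    GridInCell i' j' (cellVertices ι hi hj) ↔ i' = i ∧ j' = j := by
  simp [GridInCell, cellVertices, or_imp, forall_and, inCell_gridPoint_inl, inCell_gridPoint_inr]
  omega

lemma isFace_cellVertices (R : StaircaseRegions A B ι) (hi : i < A) (hj : j < B) :
    R.IsFace (cellVertices ι hi hj) ↔ ∀ b, ¬ R.Mem b i j := by
  refine ⟨fun h b => ?_, fun h => ?_⟩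
  · obtain ⟨i', -, j', -, hm, hc⟩ := h.retained b
    obtain ⟨rfl, rfl⟩ := (gridInCell_cellVertices hi hj).1 hc
    exact hm
  · have hc : GridInCell i j (cellVertices ι hi hj) :=
      (gridInCell_cellVertices hi hj).2 ⟨rfl, rfl⟩
    exact ⟨⟨i, hi, j, hj, hc⟩, fun b => ⟨i, hi, j, hj, h b, hc⟩, by simp [cellVertices],
      by simp [cellVertices], by simp [cellVertices]⟩

end StaircaseRegions

/-- The staircase regions in an `m × m` arrangement of `m × m` blocks of cells, one region below the
diagonal of each block, where `ε` decides which diagonal cells are included. -/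
def blockRegions {m B : ℕ} (hm : 2 ≤ m) (hB : m * m + 2 ≤ B)
    (ε : Fin m × Fin m → Fin m → Bool) : StaircaseRegions (m * m + 2) B (Fin m × Fin m) where
  Mem b i j := ∃ u v : Fin m, i = 1 + m * b.1 + u ∧ j = 1 + m * b.2 + v ∧
    (v < u ∨ v = u ∧ ε b u)
  col b := 1 + m * b.1 + (m - 1)
  row b := 1 + m * b.2
  A_pos := by omega
  B_pos := by omega
  corner_mem b := ⟨⟨m - 1, by omega⟩, ⟨0, by omega⟩, rfl, rfl, .inl (by
    rw [Fin.lt_def]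
    change 0 < m - 1
    omega)⟩
  col_lt b := by
    have := Nat.mul_le_mul_left m (Nat.succ_le_of_lt b.1.2)
    rw [Nat.mul_succ] at this
    omega
  row_pos b := by omega
  bounds := by
    rintro b i j ⟨u, v, rfl, rfl, -⟩
    have := Nat.mul_le_mul_left m (Nat.succ_le_of_lt b.2.2)
    rw [Nat.mul_succ] at this
    omega
  staircase := by
    rintro b i j i' j' ⟨u, v, rfl, rfl, h⟩ h1 h2 h3 h4
    refine ⟨⟨i' - (1 + m * b.1), by omega⟩, ⟨j' - (1 + m * b.2), by omega⟩, ?_, ?_, ?_⟩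
    · simp only
      omega
    · simp only
      omega
    · by_cases huv : i' = 1 + m * b.1 + u ∧ j' = 1 + m * b.2 + v
      · obtain ⟨rfl, rfl⟩ := huv
        simpa using h
      · left
        have : v ≤ u := h.elim le_of_lt fun h => h.1.le
        rw [Fin.le_def] at this
        rw [Fin.lt_def]
        simp only
        omega
  disjoint := by
    rintro ⟨b₁, b₂⟩ ⟨b₁', b₂'⟩ i j ⟨u, v, rfl, rfl, -⟩ ⟨u', v', h1, h2, -⟩
    have key : ∀ a a' c c' : Fin m, 1 + m * a + c = 1 + m * a' + c' → a = a' := by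
      intro a a' c c' h
      have h' : (m * a + c : ℕ) / m = (m * a' + c') / m := by
        congr 1
        omega
      rw [Nat.mul_add_div (by omega), Nat.mul_add_div (by omega), Nat.div_eq_of_lt c.2,
        Nat.div_eq_of_lt c'.2] at h'
      exact Fin.ext h'
    exact Prod.ext (key _ _ _ _ h1) (key _ _ _ _ h2)

lemma eq_of_forall_isFace_iff {m B : ℕ} {hm : 2 ≤ m} {hB : m * m + 2 ≤ B}
    {ε ε' : Fin m × Fin m → Fin m → Bool}
    (h : ∀ S : Finset _, S.Nonempty →
      ((blockRegions hm hB ε).IsFace S ↔ (blockRegions hm hB ε').IsFace S)) : ε = ε' := by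
  have key : ∀ ε (b : Fin m × Fin m) (u : Fin m), (∀ b', ¬ (blockRegions hm hB ε).Mem b'
      (1 + m * b.1 + u) (1 + m * b.2 + u)) ↔ ε b u = false := by
    intro ε b u
    rw [← Bool.not_eq_true]
    constructor
    · exact fun h hε => h b ⟨u, u, rfl, rfl, .inr ⟨rfl, hε⟩⟩
    · intro hε b' hb'
      have hfill : (blockRegions hm hB fun _ _ => true).Mem b' (1 + m * b.1 + u) (1 + m * b.2 + u) := by
        obtain ⟨u', v', h1, h2, h3⟩ := hb'
        exact ⟨u', v', h1, h2, h3.imp_right fun h => ⟨h.1, rfl⟩⟩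
      obtain rfl := (blockRegions hm hB fun _ _ => true).disjoint hfill ⟨u, u, rfl, rfl, .inr ⟨rfl, rfl⟩⟩
      obtain ⟨u', v', h1, h2, h3⟩ := hb'
      obtain rfl : u = u' := Fin.ext (by omega)
      obtain rfl : u = v' := Fin.ext (by omega)
      exact hε (h3.elim (fun h => absurd h (lt_irrefl _)) fun h => h.2)
  funext b u
  have hlt : ∀ a : Fin m, 1 + m * a + u < m * m + 2 := fun a => by
    have := Nat.mul_le_mul_left m (Nat.succ_le_of_lt a.2)
    rw [Nat.mul_succ] at this
    omega
  have := h (StaircaseRegions.cellVertices _ (hlt b.1) ((hlt b.2).trans_le hB))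
    (by simp [StaircaseRegions.cellVertices])
  rw [StaircaseRegions.isFace_cellVertices, StaircaseRegions.isFace_cellVertices, key, key] at this
  cases h1 : ε b u <;> cases h2 : ε' b u <;> simp_all

/-- Among structures on a finite set that are pairwise distinct, at least a fraction `1 / |V|!` is
pairwise inequivalent under relabelling. -/
lemma exists_pairwise_not_equivalent {α V : Type*} [Fintype α] [Fintype V] [DecidableEq V]
    (F : α → Finset V → Prop)
    (hF : ∀ a b, (∀ S : Finset V, S.Nonempty → (F a S ↔ F b S)) → a = b) :
    ∃ (k : ℕ) (f : Fin k → α), Fintype.card α ≤ k * (Fintype.card V).factorial ∧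
      ∀ i j, i ≠ j → ¬ ∃ σ : Equiv.Perm V, ∀ S : Finset V, S.Nonempty →
        (F (f i) S ↔ F (f j) (S.image σ)) := by
  classical
  let s : Setoid α :=
    { r := fun a b => ∃ σ : Equiv.Perm V, ∀ S : Finset V, S.Nonempty →
        (F a S ↔ F b (S.image σ))
      iseqv :=
        { refl := fun a => ⟨1, fun S _ => by simp⟩
          symm := by
            rintro a b ⟨σ, h⟩
            refine ⟨σ⁻¹, fun S hS => ?_⟩
            rw [h _ (hS.image _), image_image]
            simp [Function.comp_def]
          trans := by
            rintro a b c ⟨σ, h⟩ ⟨τ, h'⟩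
            refine ⟨τ * σ, fun S hS => ?_⟩
            rw [h _ hS, h' _ (hS.image _), image_image]
            simp } }
  have hout : ∀ a : α, ∃ σ : Equiv.Perm V, ∀ S : Finset V, S.Nonempty →
      (F a S ↔ F (⟦a⟧ : Quotient s).out (S.image σ)) :=
    fun a => s.symm (Quotient.mk_out a)
  choose σ hσ using hout
  refine ⟨Fintype.card (Quotient s), fun i => ((Fintype.equivFin _).symm i).out, ?_, ?_⟩
  · rw [← Fintype.card_perm, ← Fintype.card_prod]
    refine Fintype.card_le_of_injective (fun a => ((⟦a⟧ : Quotient s), σ a)) fun a b hab => ?_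
    obtain ⟨h1, h2⟩ := Prod.mk.inj hab
    exact hF a b fun S hS => by rw [hσ a S hS, hσ b S hS, h1, h2]
  · intro i j hij h
    exact hij ((Fintype.equivFin (Quotient s)).symm.injective (Quotient.out_equiv_out.1 h))

/-- There are at least `2 ^ m³ / n!` pairwise non-isomorphic triangulations of the 3-sphere with `n`
vertices in `ℝ⁴`, provided that `3 m² + 7 ≤ n`. -/
lemma exists_triangulated_three_spheres {m n : ℕ} (hm : 2 ≤ m) (hn : 3 * (m * m) + 7 ≤ n) :
    ∃ (k : ℕ) (K : Fin k → SimplicialComplex ℝ (EuclideanSpace ℝ (Fin 4))),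
      2 ^ (m * m * m) ≤ k * n.factorial ∧
      (∀ i, (K i).vertices.ncard = n) ∧
      (∀ i, Nonempty ((K i).space ≃ₜ
        (Metric.sphere (0 : EuclideanSpace ℝ (Fin 4)) 1 : Set (EuclideanSpace ℝ (Fin 4))))) ∧
      (∀ i j, i ≠ j → ¬ CombinatoriallyIsomorphic (K i) (K j)) := by
  obtain ⟨B, hB, rfl⟩ : ∃ B, m * m + 2 ≤ B ∧ n = 2 * (m * m) + 5 + B :=
    ⟨n - (2 * (m * m) + 5), by omega, by omega⟩
  have hcard : Fintype.card (StaircaseRegions.Vertex (m * m + 2) B (Fin m × Fin m)) =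
      2 * (m * m) + 5 + B := by
    simp only [StaircaseRegions.Vertex, Fintype.card_option, Fintype.card_sum, Fintype.card_prod,
      Fintype.card_fin]
    omega
  obtain ⟨k, f, hk, hf⟩ := exists_pairwise_not_equivalent
    (fun ε => (blockRegions hm hB ε).IsFace) fun ε ε' h => eq_of_forall_isFace_iff h
  refine ⟨k, fun i => (blockRegions hm hB (f i)).toPlacedComplex.toSimplicialComplex, ?_, ?_, ?_, ?_⟩
  · rw [hcard] at hk
    refine le_of_eq_of_le ?_ hk
    simp [← pow_mul, mul_comm m (m * m)]
  · intro i
    rw [PlacedComplex.vertices_eq, Set.ncard_range_of_injective (PlacedComplex.pos_injective _),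
      Nat.card_eq_fintype_card, hcard]
  · intro i
    rw [StaircaseRegions.space_eq]
    exact nonempty_frontier_body_homeomorph (by omega) (by omega)
  · exact fun i j hij h => hf i j hij (PlacedComplex.exists_perm_of_combinatoriallyIsomorphic _ _ h)

lemma rpow_mul_factorial_le {m n : ℕ} {t : ℝ} (ht : 192 ≤ t) (hn : (n : ℝ) = t ^ 4)
    (hlog : Real.log n ≤ t) (hm : n < 4 * ((m + 1) * (m + 1))) :
    (2 : ℝ) ^ (t ^ 5) * n.factorial ≤ 2 ^ (m * m * m) := by
  have hm' : t ^ 2 / 4 ≤ m := by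
    have h1 : t ^ 4 < (2 * ((m : ℝ) + 1)) ^ 2 := by
      rw [← hn]
      have : (n : ℝ) < 4 * ((m + 1) * (m + 1)) := by exact_mod_cast hm
      linarith
    have h2 : t ^ 2 < 2 * ((m : ℝ) + 1) := by
      refine lt_of_pow_lt_pow_left₀ 2 (by positivity) ?_
      rwa [← pow_mul]
    nlinarith
  have hfact : (n.factorial : ℝ) ≤ 2 ^ (2 * t ^ 5) := by
    have hn0 : (0 : ℝ) < n := by rw [hn]; positivity
    have h2 := Real.log_two_gt_d9
    have h1 : (n : ℝ) ^ n ≤ 2 ^ (2 * t ^ 5) := by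
      rw [← Real.rpow_natCast, Real.rpow_def_of_pos hn0, Real.rpow_def_of_pos two_pos,
        Real.exp_le_exp]
      calc Real.log n * n ≤ t * n := by gcongr
        _ = 1 * t ^ 5 := by rw [hn]; ring
        _ ≤ (2 * Real.log 2) * t ^ 5 := by gcongr; linarith
        _ = _ := by ring
    exact le_trans (by exact_mod_cast n.factorial_le_pow) h1
  calc (2 : ℝ) ^ (t ^ 5) * n.factorial ≤ 2 ^ (t ^ 5) * 2 ^ (2 * t ^ 5) := by gcongr
    _ = 2 ^ (3 * t ^ 5) := by rw [← Real.rpow_add two_pos]; ring_nf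
    _ ≤ 2 ^ ((m * m * m : ℕ) : ℝ) := by
      refine Real.rpow_le_rpow_of_exponent_le one_le_two ?_
      push_cast
      calc 3 * t ^ 5 ≤ t ^ 2 / 4 * (t ^ 2 / 4) * (t ^ 2 / 4) := by
            have : 0 ≤ (t - 192) * t ^ 5 := mul_nonneg (by linarith) (by positivity)
            linarith
        _ ≤ (m : ℝ) * m * m := by gcongr
    _ = _ := Real.rpow_natCast _ _

/-- There is a constant `c > 0` such that, for all sufficiently large `n`, there exist
at least `2 ^ (c * n ^ (5/4))` simplicial complexes, each with exactly `n` vertices and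
underlying space homeomorphic to the 3-sphere `S³`, that are pairwise combinatorially
non-isomorphic. -/
theorem many_triangulated_three_spheres :
    ∃ c : ℝ, 0 < c ∧ ∀ᶠ n : ℕ in Filter.atTop,
      ∃ (m : ℕ) (d : Fin m → ℕ)
        (K : ∀ i : Fin m, SimplicialComplex ℝ (EuclideanSpace ℝ (Fin (d i)))),
        (2 : ℝ) ^ (c * (n : ℝ) ^ ((5 : ℝ) / 4)) ≤ (m : ℝ) ∧
        (∀ i, (K i).vertices.ncard = n) ∧
        (∀ i, Nonempty
          ((K i).space ≃ₜ (Metric.sphere (0 : EuclideanSpace ℝ (Fin 4)) 1 : Set (EuclideanSpace ℝ (Fin 4))))) ∧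
        (∀ i j, i ≠ j → ¬ CombinatoriallyIsomorphic (K i) (K j)) := by
  refine ⟨1, one_pos, ?_⟩
  have hlog : ∀ᶠ n : ℕ in Filter.atTop, Real.log n ≤ (n : ℝ) ^ ((1 : ℝ) / 4) := by
    have h := ((isLittleO_log_rpow_atTop (r := 1 / 4) (by norm_num)).bound one_pos).natCast_atTop
    filter_upwards [h] with n hn
    have := (le_abs_self _).trans hn
    rwa [one_mul, Real.norm_of_nonneg (by positivity)] at this
  have hlarge : ∀ᶠ n : ℕ in Filter.atTop, 192 ≤ (n : ℝ) ^ ((1 : ℝ) / 4) :=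
    ((tendsto_rpow_atTop (by norm_num)).comp tendsto_natCast_atTop_atTop).eventually_ge_atTop _
  filter_upwards [hlog, hlarge, Filter.eventually_ge_atTop 28] with n hlog ht hn
  have hpow : ∀ k : ℕ, ((n : ℝ) ^ ((1 : ℝ) / 4)) ^ k = (n : ℝ) ^ ((k : ℝ) / 4) := fun k => by
    rw [← Real.rpow_natCast, ← Real.rpow_mul n.cast_nonneg]
    ring_nf
  have hsqrt := (n / 4).sqrt_le
  have hsqrt' := (n / 4).lt_succ_sqrt
  obtain ⟨k, K, hk, hvert, hspace, hK⟩ := exists_triangulated_three_spheres (m := (n / 4).sqrt)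
    (n := n) (Nat.le_sqrt.2 (by omega)) (by omega)
  refine ⟨k, fun _ => 4, K, ?_, hvert, hspace, hK⟩
  have hle := rpow_mul_factorial_le (n := n) (m := (n / 4).sqrt) ht
    (by rw [hpow]; norm_num) hlog (by rw [Nat.succ_eq_add_one] at hsqrt'; omega)
  rw [hpow] at hle
  rw [one_mul]
  refine le_of_mul_le_mul_right (hle.trans ?_) (Nat.cast_pos.2 n.factorial_pos)
  exact_mod_cast hk
end

section
/- Every vertex x ∈ F lies in exactly q−1 of the q polygons F(s), s ∈ F; more precisely, x ∈ F(s) if and only if s ≠ x + (α−1)⁻¹, so the number of s ∈ F with x ∈ F(s) equals q−1. -/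
/-- Heffter's vertex function: `v(s,k) = s + (α^k - 1)/(α - 1)`. -/
noncomputable def heffterV {F : Type*} [Field F] (α s : F) (k : ℤ) : F :=
  s + (α ^ k - 1) / (α - 1)

theorem heffterV_eq_iff {F : Type*} [Field F] {α : F} (hα : α ≠ 1) (s x : F) (k : ℤ) :
    heffterV α s k = x ↔ α ^ k = (x + (α - 1)⁻¹ - s) * (α - 1) := by
  have h : α - 1 ≠ 0 := sub_ne_zero.mpr hα
  have h' : (x + (α - 1)⁻¹ - s) * (α - 1) = (x - s) * (α - 1) + 1 := by
    field_simp
    ring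
  rw [heffterV, h', ← eq_sub_iff_add_eq', div_eq_iff h, sub_eq_iff_eq_add]

theorem exists_heffterV_eq_iff {F : Type*} [Field F] {α : F} (h0 : α ≠ 0) (h1 : α ≠ 1)
    (hα : ∀ x : F, x ≠ 0 → ∃ k : ℤ, α ^ k = x) (x s : F) :
    (∃ k : ℤ, heffterV α s k = x) ↔ s ≠ x + (α - 1)⁻¹ := by
  simp only [heffterV_eq_iff h1]
  constructor
  · rintro ⟨k, hk⟩ rfl
    rw [sub_self, zero_mul] at hk
    exact zpow_ne_zero k h0 hk
  · intro hs
    exact hα _ (mul_ne_zero (sub_ne_zero.mpr hs.symm) (sub_ne_zero.mpr h1))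

theorem heffter_vertex_in_polygons {F : Type*} [Field F] [Fintype F] (q : ℕ)
    (hcard : Fintype.card F = q) (hq4 : q % 4 = 1) (hq5 : 5 ≤ q)
    (α : F) (hα : ∀ x : F, x ≠ 0 → ∃ k : ℤ, α ^ k = x) :
    (∀ x s : F, (∃ k : ℤ, heffterV α s k = x) ↔ s ≠ x + (α - 1)⁻¹) ∧
      (∀ x : F, {s : F | ∃ k : ℤ, heffterV α s k = x}.ncard = q - 1) := by
  classical
  obtain ⟨y, hy⟩ : ∃ y : F, y ∉ ({0, 1} : Finset F) := by
    by_contra! h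
    have h2 : Fintype.card F ≤ 2 :=
      (Finset.card_le_card fun y _ => h y).trans Finset.card_le_two
    omega
  simp only [Finset.mem_insert, Finset.mem_singleton, not_or] at hy
  obtain ⟨k, hk⟩ := hα y hy.1
  have h0 : α ≠ 0 := by
    rintro rfl
    rcases eq_or_ne k 0 with rfl | hk0
    · exact hy.2 (by rw [← hk, zpow_zero])
    · exact hy.1 (by rw [← hk, zero_zpow k hk0])
  have h1 : α ≠ 1 := by
    rintro rfl
    exact hy.2 (by rw [← hk, one_zpow])
  have key := exists_heffterV_eq_iff h0 h1 hα
  refine ⟨key, fun x => ?_⟩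
  have hset : {s : F | ∃ k : ℤ, heffterV α s k = x} = {x + (α - 1)⁻¹}ᶜ := by
    ext s
    exact key x s
  rw [hset, Set.ncard_compl, Set.ncard_singleton, Nat.card_eq_fintype_card, hcard]
end

section
/- For any two distinct elements s, t ∈ F, the polygons F(s) and F(t) share exactly q−2 vertices: |F(s) ∩ F(t)| = q−2. Since q−2 ≥ 3, any two 2-cells of the Heffter cellulation intersect in more than one edge, so the cellulation is not strongly regular. -/
/-- The vertices of the polygon based at `s` are all field elements but `s - 1 / (α - 1)`. -/
theorem setOf_heffterV_eq {F : Type*} [Field F] {α : F} (h0 : α ≠ 0) (h1 : α ≠ 1)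
    (hα : ∀ x : F, x ≠ 0 → ∃ k : ℤ, α ^ k = x) (s : F) :
    {x : F | ∃ k : ℤ, heffterV α s k = x} = {s - 1 / (α - 1)}ᶜ := by
  have h : α - 1 ≠ 0 := sub_ne_zero.mpr h1
  ext x
  simp only [Set.mem_ofPred_eq, Set.mem_compl_iff, Set.mem_singleton_iff, heffterV]
  constructor
  · rintro ⟨k, rfl⟩ hk
    apply zpow_ne_zero k h0
    field_simp at hk
    linear_combination hk
  · intro hx
    obtain ⟨k, hk⟩ := hα ((x - s) * (α - 1) + 1) fun hc => hx (by
      field_simp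
      linear_combination hc)
    refine ⟨k, ?_⟩
    rw [hk]
    field_simp
    ring

/-- In a field with more than two elements, a generator of the unit group is neither `0` nor `1`. -/
theorem ne_zero_and_ne_one_of_forall_exists_zpow_eq {F : Type*} [Field F] [Fintype F]
    (hF : 2 < Fintype.card F) {α : F} (hα : ∀ x : F, x ≠ 0 → ∃ k : ℤ, α ^ k = x) :
    α ≠ 0 ∧ α ≠ 1 := by
  classical
  obtain ⟨x, hx⟩ : ∃ x, x ∉ ({0, 1} : Finset F) := by
    by_contra! h
    have := Finset.card_le_card (fun x _ => h x : Finset.univ ⊆ ({0, 1} : Finset F))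
    have := Finset.card_le_two (a := (0 : F)) (b := 1)
    rw [Finset.card_univ] at *
    omega
  simp only [Finset.mem_insert, Finset.mem_singleton, not_or] at hx
  obtain ⟨k, hk⟩ := hα x hx.1
  constructor
  · rintro rfl
    rw [zero_zpow_eq] at hk
    split_ifs at hk
    · exact hx.2 hk.symm
    · exact hx.1 hk.symm
  · rintro rfl
    exact hx.2 (by rw [← hk, one_zpow])

theorem heffter_polygons_intersect {F : Type*} [Field F] [Fintype F] (q : ℕ)
    (hcard : Fintype.card F = q) (hq4 : q % 4 = 1) (hq5 : 5 ≤ q)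
    (α : F) (hα : ∀ x : F, x ≠ 0 → ∃ k : ℤ, α ^ k = x) :
    ∀ s t : F, s ≠ t →
      ({x : F | ∃ k : ℤ, heffterV α s k = x} ∩ {x : F | ∃ k : ℤ, heffterV α t k = x}).ncard
        = q - 2 := by
  intro s t hst
  obtain ⟨h0, h1⟩ := ne_zero_and_ne_one_of_forall_exists_zpow_eq (by omega) hα
  rw [setOf_heffterV_eq h0 h1 hα, setOf_heffterV_eq h0 h1 hα, ← Set.compl_union,
    Set.singleton_union, Set.ncard_compl, Set.ncard_pair (by simpa using hst),
    Nat.card_eq_fintype_card, hcard]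
end

section
/- The Heffter cellulation is neighborly: for any two distinct elements x, y ∈ F there exist s ∈ F and k ∈ ℤ such that v(s,k) = x and v(s,k+1) = y; that is, every ordered pair of distinct vertices occurs as a pair of consecutive vertices of some polygon F(s). -/
/-- In a field with more than two elements, an element whose integer powers exhaust the nonzero
elements is neither `0` nor `1`. -/
theorem ne_zero_and_ne_one_of_zpow_surjective {F : Type*} [Field F] [Fintype F]
    (hF : 2 < Fintype.card F) (α : F) (hα : ∀ x : F, x ≠ 0 → ∃ k : ℤ, α ^ k = x) :
    α ≠ 0 ∧ α ≠ 1 := by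
  classical
  obtain ⟨x, -, hx⟩ : ∃ x ∈ (Finset.univ : Finset F), x ∉ ({0, 1} : Finset F) :=
    Finset.exists_mem_notMem_of_card_lt_card (Finset.card_le_two.trans_lt hF)
  simp only [Finset.mem_insert, Finset.mem_singleton, not_or] at hx
  obtain ⟨k, hk⟩ := hα x hx.1
  refine ⟨?_, ?_⟩
  · rintro rfl
    rw [zero_zpow_eq] at hk
    split_ifs at hk
    · exact hx.2 hk.symm
    · exact hx.1 hk.symm
  · rintro rfl
    exact hx.2 (by rw [← hk, one_zpow])

/-- Consecutive vertices of a Heffter polygon differ by a power of `α`. -/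
theorem heffterV_add_one {F : Type*} [Field F] {α : F} (h0 : α ≠ 0) (h1 : α ≠ 1) (s : F) (k : ℤ) :
    heffterV α s (k + 1) = heffterV α s k + α ^ k := by
  have h : α - 1 ≠ 0 := sub_ne_zero.mpr h1
  unfold heffterV
  rw [zpow_add_one₀ h0]
  field_simp
  ring

theorem heffter_neighborly {F : Type*} [Field F] [Fintype F] (q : ℕ)
    (hcard : Fintype.card F = q) (hq4 : q % 4 = 1) (hq5 : 5 ≤ q)
    (α : F) (hα : ∀ x : F, x ≠ 0 → ∃ k : ℤ, α ^ k = x) :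
    ∀ x y : F, x ≠ y → ∃ (s : F) (k : ℤ), heffterV α s k = x ∧ heffterV α s (k + 1) = y := by
  intro x y hxy
  obtain ⟨h0, h1⟩ := ne_zero_and_ne_one_of_zpow_surjective (by omega) α hα
  obtain ⟨k, hk⟩ := hα (y - x) (sub_ne_zero.mpr hxy.symm)
  have hx : heffterV α (x - (α ^ k - 1) / (α - 1)) k = x := sub_add_cancel _ _
  refine ⟨_, k, hx, ?_⟩
  rw [heffterV_add_one h0 h1, hx, hk, add_sub_cancel]
end

section
/- Each ordered pair of distinct vertices occurs as a directed edge of exactly one polygon in exactly one position: if s, t ∈ F and j, k ∈ ℤ satisfy v(s,k) = v(t,j) and v(s,k+1) = v(t,j+1), then s = t and (q−1) divides j−k. -/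
/-- If the powers of `α` exhaust the units of a finite field, then `α ^ n = 1` only when
`card F - 1` divides `n`. -/
theorem card_sub_one_dvd_of_zpow_eq_one {F : Type*} [Field F] [Fintype F] {α : F} (h0 : α ≠ 0)
    (hα : ∀ x : F, x ≠ 0 → ∃ k : ℤ, α ^ k = x) {n : ℤ} (hn : α ^ n = 1) :
    (Fintype.card F : ℤ) - 1 ∣ n := by
  classical
  have hgen : ∀ x : Fˣ, x ∈ Subgroup.zpowers (Units.mk0 α h0) := fun x => by
    obtain ⟨k, hk⟩ := hα x x.ne_zero
    exact ⟨k, Units.ext (by simpa using hk)⟩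
  have hord : orderOf (Units.mk0 α h0) = Fintype.card F - 1 := by
    rw [orderOf_eq_card_of_forall_mem_zpowers hgen, Nat.card_eq_fintype_card, Fintype.card_units]
  have hdvd : (orderOf (Units.mk0 α h0) : ℤ) ∣ n :=
    orderOf_dvd_iff_zpow_eq_one.mpr (Units.ext (by simpa using hn))
  rwa [hord, Nat.cast_sub Fintype.card_pos, Nat.cast_one] at hdvd

theorem heffter_directed_edge_unique {F : Type*} [Field F] [Fintype F] (q : ℕ)
    (hcard : Fintype.card F = q) (hq4 : q % 4 = 1) (hq5 : 5 ≤ q)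
    (α : F) (hα : ∀ x : F, x ≠ 0 → ∃ k : ℤ, α ^ k = x) :
    ∀ (s t : F) (j k : ℤ), heffterV α s k = heffterV α t j →
      heffterV α s (k + 1) = heffterV α t (j + 1) → s = t ∧ ((q : ℤ) - 1) ∣ j - k := by
  classical
  intro s t j k h h'
  obtain ⟨x, hx⟩ : ∃ x : F, x ∉ ({0, 1} : Finset F) := by
    by_contra! hall
    have hle := Finset.card_le_card (fun x _ => hall x : Finset.univ ⊆ ({0, 1} : Finset F))
    have htwo := Finset.card_le_two (a := (0 : F)) (b := 1)
    rw [Finset.card_univ] at hle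
    omega
  simp only [Finset.mem_insert, Finset.mem_singleton, not_or] at hx
  obtain ⟨m, hm⟩ := hα x hx.1
  have h0 : α ≠ 0 := by
    rintro rfl
    rw [zero_zpow_eq] at hm
    split_ifs at hm
    · exact hx.2 hm.symm
    · exact hx.1 hm.symm
  have h1 : α ≠ 1 := by
    rintro rfl
    exact hx.2 (by rw [← hm, one_zpow])
  rw [heffterV_add_one h0 h1, heffterV_add_one h0 h1, h, add_right_inj] at h'
  refine ⟨?_, ?_⟩
  · simpa [heffterV, h'] using h
  · rw [← hcard]
    refine card_sub_one_dvd_of_zpow_eq_one h0 hα ?_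
    rw [zpow_sub₀ h0, h', div_self (zpow_ne_zero j h0)]
end

section
/- The edge set of the Heffter cellulation consists of all pairs of vertices: the collection of unordered pairs { {v(s,k), v(s,k+1)} : s ∈ F, k ∈ ℤ } is exactly the collection of all 2-element subsets of F; in particular the cellulation has exactly q(q−1)/2 = C(q,2) edges, confirming the middle entry of its f-vector (q, q(q−1)/2, q). -/
theorem exists_ne_zero_ne_one {F : Type*} [Field F] [Fintype F] (h : 2 < Fintype.card F) :
    ∃ x : F, x ≠ 0 ∧ x ≠ 1 := by
  classical
  have hlt : ({0, 1} : Finset F).card < (Finset.univ : Finset F).card :=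
    Finset.card_le_two.trans_lt (by rwa [Finset.card_univ])
  obtain ⟨x, -, hx⟩ := Finset.exists_mem_notMem_of_card_lt_card hlt
  exact ⟨x, by simpa using hx⟩

theorem ncard_setOf_pairs (V : Type*) [Fintype V] :
    {e : Set V | ∃ x y : V, x ≠ y ∧ e = {x, y}}.ncard = (Fintype.card V).choose 2 := by
  classical
  have h : {e : Set V | ∃ x y : V, x ≠ y ∧ e = {x, y}} =
      (fun t : Finset V => (t : Set V)) ''
        ((Finset.univ : Finset V).powersetCard 2 : Set (Finset V)) := by
    ext e
    simp only [Set.mem_ofPred_eq, Set.mem_image, Finset.mem_coe, Finset.mem_powersetCard_univ,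
      Finset.card_eq_two]
    constructor
    · rintro ⟨x, y, hxy, rfl⟩
      exact ⟨{x, y}, ⟨x, y, hxy, rfl⟩, by simp⟩
    · rintro ⟨_, ⟨x, y, hxy, rfl⟩, rfl⟩
      exact ⟨x, y, hxy, by simp⟩
  rw [h, Set.ncard_image_of_injective _ Finset.coe_injective, Set.ncard_coe_finset,
    Finset.card_powersetCard, Finset.card_univ]

theorem heffter_edge_set {F : Type*} [Field F] [Fintype F] (q : ℕ)
    (hcard : Fintype.card F = q) (hq4 : q % 4 = 1) (hq5 : 5 ≤ q)
    (α : F) (hα : ∀ x : F, x ≠ 0 → ∃ k : ℤ, α ^ k = x) :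
    {e : Set F | ∃ (s : F) (k : ℤ), e = {heffterV α s k, heffterV α s (k + 1)}} =
        {e : Set F | ∃ x y : F, x ≠ y ∧ e = {x, y}} ∧
      {e : Set F | ∃ (s : F) (k : ℤ),
        e = {heffterV α s k, heffterV α s (k + 1)}}.ncard = q * (q - 1) / 2 := by
  obtain ⟨z, hz0, hz1⟩ := exists_ne_zero_ne_one (F := F) (by omega)
  obtain ⟨m, hm⟩ := hα z hz0
  have h0 : α ≠ 0 := by
    rintro rfl
    rw [zero_zpow_eq] at hm
    split_ifs at hm
    · exact hz1 hm.symm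
    · exact hz0 hm.symm
  have h1 : α ≠ 1 := by
    rintro rfl
    exact hz1 (by simpa using hm.symm)
  have hset : {e : Set F | ∃ (s : F) (k : ℤ), e = {heffterV α s k, heffterV α s (k + 1)}} =
      {e : Set F | ∃ x y : F, x ≠ y ∧ e = {x, y}} := by
    ext e
    constructor
    · rintro ⟨s, k, rfl⟩
      refine ⟨_, _, ?_, rfl⟩
      rw [heffterV_add_one h0 h1]
      simpa using (zpow_ne_zero k h0)
    · rintro ⟨x, y, hxy, rfl⟩
      obtain ⟨k, hk⟩ := hα (y - x) (sub_ne_zero.mpr hxy.symm)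
      have hx : heffterV α (x - (α ^ k - 1) / (α - 1)) k = x := sub_add_cancel _ _
      refine ⟨x - (α ^ k - 1) / (α - 1), k, ?_⟩
      rw [heffterV_add_one h0 h1, hx, hk, add_sub_cancel]
  refine ⟨hset, ?_⟩
  rw [hset, ncard_setOf_pairs, hcard, Nat.choose_two_right]
end
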